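/- arXiv:2505.24490 — 5 statements merged into one kernel-verified Lean document; each statement's English description precedes it below -/
import Mathlib

section
/- For every positive integer m, set k = m². Then for every N there exist an integer n ≥ N, a set V of n points in the plane in convex position, and a set E of edges on V forming an outer k-planar graph, such that |E| ≥ m·n (i.e., at least √k·n edges). -/
open scoped Classical

/-- A point in the plane. -/
abbrev Pt := EuclideanSpace ℝ (Fin 2)

/-- A finite point set is in convex position (convexly independent). -/
def ConvexPos (V : Finset Pt) : Prop :=
  ∀ p ∈ V, p ∉ convexHull ℝ ((V.erase p : Finset Pt) : Set Pt)

/-- The open straight-line segment drawn for an unordered pair of points. -/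
noncomputable def edgeSeg (e : Sym2 Pt) : Set Pt :=
  Sym2.lift ⟨fun a b => openSegment ℝ a b, fun a b => openSegment_symm ℝ a b⟩ e

/-- Two distinct edges cross if their open segments intersect. -/
def Cross (e f : Sym2 Pt) : Prop :=
  e ≠ f ∧ (edgeSeg e ∩ edgeSeg f).Nonempty

theorem Cross_comm (e f : Sym2 Pt) : Cross e f ↔ Cross f e := by
  unfold Cross
  rw [Set.inter_comm]
  exact and_congr_left' ne_comm

/-- A convex geometric graph: points in convex position, edges are unordered
pairs of distinct points of `V`. -/
structure ConvexGeomGraph where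
  V : Finset Pt
  E : Finset (Sym2 Pt)
  convexPos : ConvexPos V
  not_diag : ∀ e ∈ E, ¬ e.IsDiag
  mem_V : ∀ e ∈ E, ∀ p ∈ e, p ∈ V

/-- A convex geometric graph is outer `k`-planar if every edge crosses at
most `k` other edges. -/
noncomputable def OuterKPlanar (G : ConvexGeomGraph) (k : ℕ) : Prop :=
  ∀ e ∈ G.E, (G.E.filter (fun f => Cross e f)).card ≤ k

/-- Bipartite: vertices can be partitioned into `A` and `B` with every edge
joining a point of `A` to a point of `B`. -/
def Bipartite (G : ConvexGeomGraph) : Prop :=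
  ∃ A B : Finset Pt, A ∪ B = G.V ∧ Disjoint A B ∧
    ∀ e ∈ G.E, ∃ a ∈ A, ∃ b ∈ B, e = s(a, b)

/-- The degree of a vertex: number of edges containing it. -/
noncomputable def degree (G : ConvexGeomGraph) (v : Pt) : ℕ :=
  (G.E.filter (fun e => v ∈ e)).card

/-- The number of unordered pairs of distinct edges that cross. -/
noncomputable def crossingNumber (E : Finset (Sym2 Pt)) : ℕ :=
  (E.sym2.filter (fun pr => Sym2.lift
    ⟨fun e f => Cross e f, fun e f => propext (Cross_comm e f)⟩ pr)).card

/-- The point of the parabola `y = x ^ 2` above the natural number `a`. -/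
noncomputable def parabolaPt (a : ℕ) : Pt := !₂[(a : ℝ), (a : ℝ) ^ 2]

@[simp] theorem parabolaPt_zero (a : ℕ) : parabolaPt a 0 = a := by simp [parabolaPt]

@[simp] theorem parabolaPt_one (a : ℕ) : parabolaPt a 1 = (a : ℝ) ^ 2 := by simp [parabolaPt]

theorem parabolaPt_injective : Function.Injective parabolaPt := by
  intro a b h
  have := congrArg (fun p : Pt => p 0) h
  simpa using this

theorem convexPos_image_parabolaPt (s : Finset ℕ) : ConvexPos (s.image parabolaPt) := by
  intro p hp hmem
  obtain ⟨a, -, rfl⟩ := Finset.mem_image.mp hp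
  have hconv : Convex ℝ {q : Pt | 0 < q 1 - 2 * a * q 0 + (a : ℝ) ^ 2} := by
    intro x hx y hy α β hα hβ hαβ
    simp only [Set.mem_ofPred_eq, PiLp.add_apply, PiLp.smul_apply, smul_eq_mul] at hx hy ⊢
    obtain rfl : β = 1 - α := by linarith
    rcases hα.eq_or_lt with rfl | hα
    · linarith
    · nlinarith [mul_pos hα hx, mul_nonneg hβ hy.le]
  have hsub : (((s.image parabolaPt).erase (parabolaPt a) : Finset Pt) : Set Pt) ⊆
      {q : Pt | 0 < q 1 - 2 * a * q 0 + (a : ℝ) ^ 2} := by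
    intro q hq
    obtain ⟨hne, hq⟩ := Finset.mem_erase.mp (Finset.mem_coe.mp hq)
    obtain ⟨b, -, rfl⟩ := Finset.mem_image.mp hq
    have hba : (b : ℝ) - a ≠ 0 := by
      intro h
      exact hne (congrArg parabolaPt (by exact_mod_cast sub_eq_zero.mp h))
    have := sq_pos_of_ne_zero hba
    simp only [Set.mem_ofPred_eq, parabolaPt_zero, parabolaPt_one]
    nlinarith
  have := convexHull_min hsub hconv hmem
  simp only [Set.mem_ofPred_eq, parabolaPt_zero, parabolaPt_one] at this
  nlinarith

theorem mem_openSegment_parabolaPt {a b : ℕ} (hab : a < b) {q : Pt}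
    (hq : q ∈ openSegment ℝ (parabolaPt a) (parabolaPt b)) :
    (a : ℝ) < q 0 ∧ q 0 < b ∧ q 1 - q 0 ^ 2 = (q 0 - a) * (b - q 0) := by
  obtain ⟨α, β, hα, hβ, hαβ, rfl⟩ := hq
  have hab' : (a : ℝ) < b := by exact_mod_cast hab
  obtain rfl : β = 1 - α := by linarith
  simp only [PiLp.add_apply, PiLp.smul_apply, smul_eq_mul, parabolaPt_zero, parabolaPt_one]
  refine ⟨?_, ?_, by ring⟩
  · nlinarith [mul_pos hβ (sub_pos.mpr hab')]
  · nlinarith [mul_pos hα (sub_pos.mpr hab')]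

/-- Crossing chords of the parabola have interleaving endpoints. -/
theorem Cross.interleave {a b c d : ℕ} (hab : a < b) (hcd : c < d)
    (h : Cross s(parabolaPt a, parabolaPt b) s(parabolaPt c, parabolaPt d)) :
    (a < c ∧ c < b ∧ b < d) ∨ (c < a ∧ a < d ∧ d < b) := by
  obtain ⟨hne, q, hq₁, hq₂⟩ := h
  obtain ⟨h₁, h₂, h₃⟩ := mem_openSegment_parabolaPt hab hq₁
  obtain ⟨h₄, h₅, h₆⟩ := mem_openSegment_parabolaPt hcd hq₂
  have hcb : c < b := by exact_mod_cast h₄.trans h₂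
  have had : a < d := by exact_mod_cast h₁.trans h₅
  have key : (q 0 - a) * (b - q 0) = (q 0 - c) * (d - q 0) := h₃.symm.trans h₆
  have hne' : ¬(a = c ∧ b = d) := by
    rintro ⟨rfl, rfl⟩
    exact hne rfl
  have nested₁ : ¬(a ≤ c ∧ d ≤ b) := by
    rintro ⟨hac, hdb⟩
    have hac' : (a : ℝ) ≤ c := by exact_mod_cast hac
    have hdb' : (d : ℝ) ≤ b := by exact_mod_cast hdb
    have hac_eq : (a : ℝ) = c := by nlinarith
    have hdb_eq : (b : ℝ) = d := by nlinarith
    exact hne' ⟨by exact_mod_cast hac_eq, by exact_mod_cast hdb_eq⟩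
  have nested₂ : ¬(c ≤ a ∧ b ≤ d) := by
    rintro ⟨hac, hdb⟩
    have hac' : (c : ℝ) ≤ a := by exact_mod_cast hac
    have hdb' : (b : ℝ) ≤ d := by exact_mod_cast hdb
    have hac_eq : (a : ℝ) = c := by nlinarith
    have hdb_eq : (b : ℝ) = d := by nlinarith
    exact hne' ⟨by exact_mod_cast hac_eq, by exact_mod_cast hdb_eq⟩
  omega

/-- The representative below `n` of `x` modulo `n`, for `x < 2 * n`. -/
def wrap (n x : ℕ) : ℕ := if x < n then x else x - n

/-- The chord joining the `i`-th of `n` cyclically ordered points on the parabola to the one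
`l` steps further. -/
noncomputable def cyclicChord (n i l : ℕ) : Sym2 Pt :=
  s(parabolaPt i, parabolaPt (wrap n (i + l)))

theorem cyclicChord_eq {n i l : ℕ} (hi : i < n) (hl : 0 < l) (hln : l < n) :
    ∃ a b, a < b ∧ b < n ∧ cyclicChord n i l = s(parabolaPt a, parabolaPt b) ∧
      ((a = i ∧ b = i + l ∧ i + l < n) ∨ (a + n = i + l ∧ b = i ∧ n ≤ i + l)) := by
  unfold cyclicChord wrap
  split_ifs with h
  · exact ⟨i, i + l, by omega, by omega, rfl, by omega⟩
  · exact ⟨i + l - n, i, by omega, hi, Sym2.eq_swap, by omega⟩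

theorem cyclicChord_injOn {m n : ℕ} (hmn : 2 * m < n) :
    Set.InjOn (fun p : ℕ × ℕ => cyclicChord n p.1 p.2)
      (Finset.range n ×ˢ Finset.Icc 1 m : Finset (ℕ × ℕ)) := by
  rintro ⟨i, l⟩ hil ⟨j, r⟩ hjr h
  simp only [Finset.coe_product, Set.mem_prod, Finset.mem_coe, Finset.mem_range,
    Finset.mem_Icc] at hil hjr
  simp only [cyclicChord, Sym2.eq_iff, parabolaPt_injective.eq_iff, wrap] at h
  rw [Prod.mk.injEq]
  split_ifs at h <;> omega

/-- A chord of length at most `m` crossing the chord from `i` of length `l` is determined by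
two numbers in `[1, m]`: its own length, and the distance from its endpoint inside the arc spanned
by the latter to the end of that arc it passes over; their order tells the direction. -/
theorem cyclicChord_mem_of_cross {m n i l j r : ℕ} (hmn : 2 * m < n) (hi : i < n) (hl : 0 < l)
    (hlm : l ≤ m) (hj : j < n) (hr : 0 < r) (hrm : r ≤ m)
    (h : Cross (cyclicChord n i l) (cyclicChord n j r)) :
    ∃ u v, (1 ≤ u ∧ u ≤ m) ∧ (1 ≤ v ∧ v ≤ m) ∧ cyclicChord n j r =
      if u < v then cyclicChord n (wrap n (wrap n (i + l) + (n - u))) v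
      else cyclicChord n (wrap n (wrap n (i + v) + (n - u))) u := by
  obtain ⟨a, b, hab, -, he, hil⟩ := cyclicChord_eq hi hl (by omega : l < n)
  obtain ⟨c, d, hcd, -, hf, hjr⟩ := cyclicChord_eq hj hr (by omega : r < n)
  rw [he, hf] at h
  have hint := h.interleave hab hcd
  have hcases : (∃ u, 1 ≤ u ∧ u < r ∧ j = wrap n (wrap n (i + l) + (n - u))) ∨
      ∃ v, 1 ≤ v ∧ v < r ∧ j = wrap n (wrap n (i + v) + (n - r)) := by
    have hor : (∃ t, 0 < t ∧ t < l ∧ l < t + r ∧ (j = i + t ∨ j + n = i + t)) ∨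
        ∃ t, 0 < t ∧ t < r ∧ t < l ∧ (j + r = i + t ∨ j + r = i + t + n ∨ j + r + n = i + t) := by
      by_cases hA : (i < j ∧ j < i + l) ∨ (i < j + n ∧ j + n < i + l)
      · left
        rcases hA with hA | hA
        · exact ⟨j - i, by omega⟩
        · exact ⟨j + n - i, by omega⟩
      · right
        by_cases hB : i < j + r ∧ j + r < i + l
        · exact ⟨j + r - i, by omega⟩
        · by_cases hC : i + n < j + r
          · exact ⟨j + r - n - i, by omega⟩
          · exact ⟨j + r + n - i, by omega⟩
    rcases hor with ⟨t, ht⟩ | ⟨t, ht⟩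
    · refine Or.inl ⟨l - t, by omega, by omega, ?_⟩
      unfold wrap
      split_ifs <;> omega
    · refine Or.inr ⟨t, by omega, by omega, ?_⟩
      unfold wrap
      split_ifs <;> omega
  rcases hcases with ⟨u, hu, hur, hju⟩ | ⟨v, hv, hvr, hjv⟩
  · exact ⟨u, r, by omega, by omega, by rw [if_pos hur, ← hju]⟩
  · exact ⟨r, v, by omega, by omega, by rw [if_neg (by omega), ← hjv]⟩

/-- The `m`-th power of the cycle on `n` points of the parabola. -/
noncomputable def cyclePower (m n : ℕ) (hmn : 2 * m < n) : ConvexGeomGraph where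
  V := (Finset.range n).image parabolaPt
  E := (Finset.range n ×ˢ Finset.Icc 1 m).image fun p => cyclicChord n p.1 p.2
  convexPos := convexPos_image_parabolaPt _
  not_diag := by
    intro e he
    simp only [Finset.mem_image, Finset.mem_product, Finset.mem_range, Finset.mem_Icc] at he
    obtain ⟨⟨i, l⟩, ⟨hi, hl, hlm⟩, rfl⟩ := he
    obtain ⟨a, b, hab, -, h, -⟩ := cyclicChord_eq hi hl (by omega : l < n)
    rw [h, Sym2.mk_isDiag_iff, parabolaPt_injective.eq_iff]
    exact hab.ne
  mem_V := by
    intro e he p hp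
    simp only [Finset.mem_image, Finset.mem_product, Finset.mem_range, Finset.mem_Icc] at he
    obtain ⟨⟨i, l⟩, ⟨hi, hl, hlm⟩, rfl⟩ := he
    obtain ⟨a, b, hab, hbn, h, -⟩ := cyclicChord_eq hi hl (by omega : l < n)
    rw [h, Sym2.mem_iff] at hp
    rcases hp with rfl | rfl <;>
      exact Finset.mem_image_of_mem _ (Finset.mem_range.mpr (by omega))

theorem outerKPlanar_cyclePower {m n : ℕ} (hmn : 2 * m < n) :
    OuterKPlanar (cyclePower m n hmn) (m ^ 2) := by
  intro e he
  simp only [cyclePower, Finset.mem_image, Finset.mem_product, Finset.mem_range,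
    Finset.mem_Icc] at he
  obtain ⟨⟨i, l⟩, ⟨hi, hl, hlm⟩, rfl⟩ := he
  calc
    _ ≤ ((Finset.Icc 1 m ×ˢ Finset.Icc 1 m).image fun p : ℕ × ℕ =>
          if p.1 < p.2 then cyclicChord n (wrap n (wrap n (i + l) + (n - p.1))) p.2
          else cyclicChord n (wrap n (wrap n (i + p.2) + (n - p.1))) p.1).card := by
      refine Finset.card_le_card fun f hf => ?_
      simp only [cyclePower, Finset.mem_filter, Finset.mem_image, Finset.mem_product,
        Finset.mem_range, Finset.mem_Icc] at hf
      obtain ⟨⟨⟨j, r⟩, ⟨hj, hr, hrm⟩, rfl⟩, hcross⟩ := hf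
      obtain ⟨u, v, hu, hv, huv⟩ := cyclicChord_mem_of_cross hmn hi hl hlm hj hr hrm hcross
      exact Finset.mem_image.mpr ⟨(u, v), by simpa using ⟨hu, hv⟩, huv.symm⟩
    _ ≤ (Finset.Icc 1 m ×ˢ Finset.Icc 1 m).card := Finset.card_image_le
    _ = m ^ 2 := by simp [sq]

/-- For every positive integer m, set k = m². For every N there is
an outer k-planar graph on n ≥ N vertices with at least m·n = √k·n edges. -/
theorem stmt0 (m : ℕ) (hm : 0 < m) (k : ℕ) (hk : k = m ^ 2) (N : ℕ) :
    ∃ n ≥ N, ∃ G : ConvexGeomGraph, G.V.card = n ∧ OuterKPlanar G k ∧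
      m * n ≤ G.E.card := by
  subst hk
  have hmn : 2 * m < N + 2 * m + 1 := by omega
  refine ⟨N + 2 * m + 1, by omega, cyclePower m _ hmn, ?_, outerKPlanar_cyclePower hmn, ?_⟩
  · simp [cyclePower, Finset.card_image_of_injective _ parabolaPt_injective]
  · have hcard := Finset.card_image_of_injOn (cyclicChord_injOn hmn)
    rw [Finset.card_product, Finset.card_range, Nat.card_Icc, Nat.add_sub_cancel] at hcard
    rw [mul_comm]
    exact hcard.ge
end

section
/- For every integer k ≥ 5, every outer k-planar graph on n vertices has at most 2.85·√k·n edges. -/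
open scoped Classical

/-- Twice the signed area of the triangle `x y z`. -/
def orient (x y z : Pt) : ℝ :=
  (y 0 - x 0) * (z 1 - x 1) - (y 1 - x 1) * (z 0 - x 0)

theorem openSegment_inter_of_orient_pos {a b c d : Pt} (h1 : 0 < orient a c b)
    (h2 : 0 < orient a b d) (h3 : 0 < orient a c d) (h4 : 0 < orient c b d) :
    (openSegment ℝ a b ∩ openSegment ℝ c d).Nonempty := by
  have hs : orient c b d + orient a c d = orient a b d + orient a c b := by
    unfold orient; ring
  have hpos : 0 < orient a b d + orient a c b := by linarith
  set T := orient a b d + orient a c b with hT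
  refine ⟨(orient c b d / T) • a + (orient a c d / T) • b,
    ⟨_, _, by positivity, by positivity, ?_, rfl⟩,
    ⟨orient a b d / T, orient a c b / T, by positivity, by positivity, ?_, ?_⟩⟩
  · rw [← add_div, hs, div_self hpos.ne']
  · rw [← add_div, div_self hpos.ne']
  · ext i
    simp only [PiLp.add_apply, PiLp.smul_apply, smul_eq_mul]
    field_simp
    fin_cases i <;> simp [orient] <;> ring

theorem ConvexPos.subset {V W : Finset Pt} (hV : ConvexPos V) (h : W ⊆ V) : ConvexPos W :=
  fun p hp hc => hV p (h hp) (convexHull_mono (by exact_mod_cast Finset.erase_subset_erase p h) hc)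

theorem ConvexPos.ne_combination {V : Finset Pt} (hV : ConvexPos V) {p x y z : Pt}
    (hp : p ∈ V) (hx : x ∈ V) (hy : y ∈ V) (hz : z ∈ V) (hyp : y ≠ p) (hyx : y ≠ x)
    (hyz : y ≠ z) {s t : ℝ} (hs : 0 ≤ s) (ht : 0 ≤ t) (hst : s + t ≤ 1) :
    y ≠ (1 - s - t) • p + s • x + t • z := by
  intro h
  apply hV y hy
  have mem : ∀ q ∈ V, y ≠ q → q ∈ convexHull ℝ ((V.erase y : Finset Pt) : Set Pt) :=
    fun q hq hne => subset_convexHull ℝ _ (by simp [hq, hne.symm])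
  have hsum := (convex_convexHull ℝ ((V.erase y : Finset Pt) : Set Pt)).sum_mem
    (t := Finset.univ) (w := ![1 - s - t, s, t]) (z := ![p, x, z])
    (by intro i _; fin_cases i <;> simp <;> linarith)
    (by simp only [Fin.sum_univ_three, Matrix.cons_val]; ring)
    (by
      intro i _
      fin_cases i
      exacts [mem p hp hyp, mem x hx hyx, mem z hz hyz])
  simp only [Fin.sum_univ_three, Matrix.cons_val] at hsum
  rwa [← h] at hsum

/-- Points in convex position can be sorted so that all triples turn counterclockwise. -/
theorem ConvexPos.exists_key {V : Finset Pt} (hV : ConvexPos V) :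
    ∃ key : Pt → WithBot ℝ, Set.InjOn key V ∧
      ∀ x ∈ V, ∀ y ∈ V, ∀ z ∈ V, key x < key y → key y < key z → 0 < orient x y z := by
  rcases V.eq_empty_or_nonempty with rfl | ⟨p, hp⟩
  · exact ⟨fun _ => ⊥, by simp, by simp⟩
  obtain ⟨f, u, hfp, hfu⟩ := geometric_hahn_banach_point_closed
    (convex_convexHull ℝ ((V.erase p : Finset Pt) : Set Pt))
    ((V.erase p).finite_toSet.isClosed_convexHull ℝ) (hV p hp)
  obtain ⟨α, β, hf⟩ : ∃ α β : ℝ, ∀ q : Pt, f q = α * q 0 + β * q 1 := by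
    refine ⟨f (EuclideanSpace.single 0 1), f (EuclideanSpace.single 1 1), fun q => ?_⟩
    have hq : q = q 0 • EuclideanSpace.single 0 1 + q 1 • EuclideanSpace.single 1 1 := by
      ext i; fin_cases i <;> simp
    conv_lhs => rw [hq]
    simp [mul_comm]
  have hpos : ∀ q ∈ V, q ≠ p → 0 < f q - f p := fun q hq hqp => by
    have := hfu q (subset_convexHull ℝ _ (by simp [hq, hqp]))
    linarith
  let g : Pt → ℝ := fun q => -β * (q 0 - p 0) + α * (q 1 - p 1)
  let slope : Pt → ℝ := fun q => g q / (f q - f p)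
  let key : Pt → WithBot ℝ := fun q => if q = p then ⊥ else (slope q : WithBot ℝ)
  have hdet : ∀ x y, (f x - f p) * g y - g x * (f y - f p) = (α ^ 2 + β ^ 2) * orient p x y := by
    intro x y; simp only [hf, g, orient]; ring
  have hslope : ∀ x ∈ V, x ≠ p → ∀ y ∈ V, y ≠ p → slope x < slope y → 0 < orient p x y := by
    intro x hx hxp y hy hyp h
    simp only [slope] at h
    rw [div_lt_div_iff₀ (hpos x hx hxp) (hpos y hy hyp)] at h
    have h' : 0 < (α ^ 2 + β ^ 2) * orient p x y := by rw [← hdet]; linarith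
    exact pos_of_mul_pos_right h' (by positivity)
  have hne : ∀ x ∈ V, x ≠ p → ∀ y ∈ V, y ≠ p → f x ≤ f y → slope x = slope y → x = y := by
    intro x hx hxp y hy hyp hle h
    by_contra hxy
    have hfx := hpos x hx hxp
    have hfy := hpos y hy hyp
    have hdet0 : (f x - f p) * g y - g x * (f y - f p) = 0 := by
      simp only [slope] at h
      rw [div_eq_div_iff hfx.ne' hfy.ne'] at h
      linarith
    have hab : 0 < α ^ 2 + β ^ 2 := by
      by_contra hc
      have h0 : α = 0 := by nlinarith [sq_nonneg α, sq_nonneg β]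
      have h1 : β = 0 := by nlinarith [sq_nonneg α, sq_nonneg β]
      simp [hf, h0, h1] at hfx
    have ho : orient p x y = 0 := by
      rw [hdet] at hdet0
      exact (mul_eq_zero.1 hdet0).resolve_left hab.ne'
    refine hV.ne_combination hp hy hx hy hxp hxy hxy
      (s := (f x - f p) / (f y - f p)) (t := 0) (by positivity) le_rfl
      (by rw [add_zero, div_le_one hfy]; linarith) ?_
    unfold orient at ho
    ext i
    simp only [PiLp.add_apply, PiLp.smul_apply, smul_eq_mul]
    field_simp
    fin_cases i
    · simp only [hf] at *; simp; linear_combination β * ho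
    · simp only [hf] at *; simp; linear_combination (-α) * ho
  refine ⟨key, ?_, ?_⟩
  · intro x hx y hy h
    simp only [key] at h
    split_ifs at h with h1 h2 h2
    · rw [h1, h2]
    · simp at h
    · simp at h
    · have h' : slope x = slope y := by exact_mod_cast h
      rcases le_total (f x) (f y) with hle | hle
      · exact hne x hx h1 y hy h2 hle h'
      · exact (hne y hy h2 x hx h1 hle h'.symm).symm
  · intro x hx y hy z hz hxy hyz
    have hyp : y ≠ p := by rintro rfl; simp [key] at hxy
    have hzp : z ≠ p := by rintro rfl; simp [key] at hyz
    have hyz' : slope y < slope z := by simpa [key, hyp, hzp] using hyz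
    have oyz := hslope y hy hyp z hz hzp hyz'
    by_cases hxp : x = p
    · rwa [hxp]
    have hxy' : slope x < slope y := by simpa [key, hyp, hxp] using hxy
    have oxy := hslope x hx hxp y hy hyp hxy'
    have oxz := hslope x hx hxp z hz hzp (hxy'.trans hyz')
    by_contra hcon
    have hsum : orient x y z = orient p x y + orient p y z - orient p x z := by
      unfold orient; ring
    refine hV.ne_combination hp hx hy hz hyp (by rintro rfl; exact hxy.false)
      (by rintro rfl; exact hyz.false)
      (s := orient p y z / orient p x z) (t := orient p x y / orient p x z)
      (by positivity) (by positivity)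
      (by rw [← add_div, div_le_one oxz]; linarith) ?_
    ext i
    simp only [PiLp.add_apply, PiLp.smul_apply, smul_eq_mul]
    field_simp
    fin_cases i <;> simp [orient] <;> ring

theorem Finset.exists_enum_of_injOn {α β : Type*} [Nonempty α] [LinearOrder β] (V : Finset α) {key : α → β}
    (hkey : Set.InjOn key V) :
    ∃ v : ℕ → α, (∀ i < V.card, v i ∈ V) ∧ (∀ x ∈ V, ∃ i < V.card, v i = x) ∧
      ∀ i < V.card, ∀ j < V.card, i < j → key (v i) < key (v j) := by
  have hcard : (V.image key).card = V.card := Finset.card_image_of_injOn hkey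
  let e := (V.image key).orderIsoOfFin hcard
  have hpre : ∀ i : Fin V.card, ∃ x ∈ V, key x = e i := fun i =>
    Finset.mem_image.1 (e i).2
  choose w hw hwe using hpre
  rcases V.eq_empty_or_nonempty with rfl | ⟨p, hp⟩
  · obtain ⟨x⟩ := ‹Nonempty α›
    exact ⟨fun _ => x, by simp, by simp, by simp⟩
  refine ⟨fun i => if h : i < V.card then w ⟨i, h⟩ else p, ?_, ?_, ?_⟩
  · intro i hi; simp [hi, hw]
  · intro x hx
    let i := e.symm ⟨key x, Finset.mem_image_of_mem _ hx⟩
    refine ⟨i, i.2, hkey (by simp [hw]) hx ?_⟩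
    simp [hwe, i]
  · intro i hi j hj hij
    simp only [hi, hj, dite_true, hwe]
    exact e.strictMono hij

/-- A graph on `0, …, n - 1` of minimum degree `δ` has an edge `i j` such that many edges lead
from vertices strictly between `i` and `j` to vertices outside `[i, j]`. -/
theorem exists_edge_many_interleaving {n δ d : ℕ} (hn : 0 < n) (hd : d < δ)
    (Adj : ℕ → ℕ → Prop) (irrefl : ∀ i, ¬ Adj i i)
    (hdeg : ∀ i < n, δ ≤ ((Finset.range n).filter (Adj i)).card) :
    ∃ i j, i < j ∧ j < n ∧ Adj i j ∧
      ∑ x ∈ Finset.range d, (δ - (x + 1 + d)) ≤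
        ((Finset.Ioo i j).sigma fun x =>
          (Finset.range n).filter fun y => Adj x y ∧ (y < i ∨ j < y)).card := by
  have hex : ∃ L, d < L ∧ ∃ i, i + L < n ∧ Adj i (i + L) := by
    by_contra! h
    have hsub : (Finset.range n).filter (Adj 0) ⊆ Finset.Ioc 0 d := by
      intro y hy
      simp only [Finset.mem_filter, Finset.mem_range, Finset.mem_Ioc] at hy ⊢
      refine ⟨Nat.pos_of_ne_zero fun h0 => irrefl 0 (h0 ▸ hy.2), ?_⟩
      by_contra! hdy
      exact h y hdy 0 (by simpa using hy.1) (by simpa using hy.2)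
    have := (hdeg 0 hn).trans (Finset.card_le_card hsub)
    simp at this
    omega
  obtain ⟨hdL, i, hiL, hadj⟩ := Nat.find_spec hex
  set L := Nat.find hex
  have hmin : ∀ x y, x < y → y < n → Adj x y → y < x + L → y ≤ x + d := by
    intro x y hxy hy ha hlt
    by_contra! hc
    refine Nat.find_min hex (m := y - x) (by omega) ⟨by omega, x, by omega, ?_⟩
    rwa [Nat.add_sub_cancel' hxy.le]
  refine ⟨i, i + L, by omega, hiL, hadj, ?_⟩
  rw [Finset.card_sigma]
  have hsub : (Finset.range d).image (fun x => i + 1 + x) ⊆ Finset.Ioo i (i + L) := by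
    intro y hy
    simp only [Finset.mem_image, Finset.mem_range, Finset.mem_Ioo] at hy ⊢
    omega
  refine le_trans ?_ (Finset.sum_le_sum_of_subset hsub)
  rw [Finset.sum_image (by intro a _ b _ h; simpa using h)]
  refine Finset.sum_le_sum fun x hx => ?_
  rw [Finset.mem_range] at hx
  have hcov : (Finset.range n).filter (Adj (i + 1 + x)) ⊆
      (Finset.range n).filter (fun y => Adj (i + 1 + x) y ∧ (y < i ∨ i + L < y)) ∪
        (Finset.Icc i (i + 1 + x + d)).erase (i + 1 + x) := by
    intro y hy
    simp only [Finset.mem_filter, Finset.mem_range, Finset.mem_union, Finset.mem_erase,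
      Finset.mem_Icc] at hy ⊢
    by_cases hout : y < i ∨ i + L < y
    · exact Or.inl ⟨hy.1, hy.2, hout⟩
    · have hne : y ≠ i + 1 + x := fun h => irrefl y (by simpa [← h] using hy.2)
      have := hmin (i + 1 + x) y
      refine Or.inr ⟨hne, by omega, ?_⟩
      by_contra! hc
      have := this (by omega) hy.1 hy.2 (by omega)
      omega
  have h1 := (hdeg (i + 1 + x) (by omega)).trans
    ((Finset.card_le_card hcov).trans (Finset.card_union_le _ _))
  rw [Finset.card_erase_of_mem (by simp; omega), Nat.card_Icc] at h1
  omega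

theorem lt_sum_of_eight_mul_lt_sq {k δ : ℕ} (hδ : 7 ≤ δ) (hk : 8 * k < δ ^ 2) :
    k < ∑ x ∈ Finset.range (δ / 3), (δ - (x + 1 + δ / 3)) := by
  have key : ∀ m d : ℕ, m ≤ d → 2 * d ≤ δ →
      2 * (∑ x ∈ Finset.range m, (δ - (x + 1 + d))) + m * (m + 1) + 2 * m * d = 2 * m * δ := by
    intro m d hm hd
    induction m with
    | zero => simp
    | succ m ih =>
      have h1 := ih (by omega)
      obtain ⟨e, he⟩ : ∃ e, δ = e + (m + 1 + d) := ⟨δ - (m + 1 + d), by omega⟩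
      rw [Finset.sum_range_succ]
      have : δ - (m + 1 + d) = e := by omega
      rw [this]
      nlinarith
  have h := key (δ / 3) (δ / 3) le_rfl (by omega)
  set S := ∑ x ∈ Finset.range (δ / 3), (δ - (x + 1 + δ / 3))
  obtain ⟨d, r, hr, rfl⟩ : ∃ d r, r < 3 ∧ δ = 3 * d + r :=
    ⟨δ / 3, δ % 3, Nat.mod_lt _ (by norm_num), (Nat.div_add_mod δ 3).symm⟩
  have hd : (3 * d + r) / 3 = d := by omega
  rw [hd] at h
  have hd2 : 2 ≤ d := by omega
  interval_cases r <;> nlinarith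

/-- An outer `k`-planar graph with `k ≥ 5` has a vertex of degree at most `2.85 √k`. -/
theorem OuterKPlanar.exists_degree_le {k : ℕ} (hk : 5 ≤ k) {G : ConvexGeomGraph}
    (hG : OuterKPlanar G k) (hne : G.V.Nonempty) :
    ∃ p ∈ G.V, (degree G p : ℝ) ≤ 2.85 * Real.sqrt k := by
  by_contra! hcon
  have hsq : Real.sqrt k ^ 2 = k := Real.sq_sqrt (Nat.cast_nonneg k)
  have hk' : (5 : ℝ) ≤ k := by exact_mod_cast hk
  have hs0 := Real.sqrt_nonneg k
  obtain ⟨δ, hδ7, hδk, hδ⟩ : ∃ δ : ℕ, 7 ≤ δ ∧ 8 * k < δ ^ 2 ∧ ∀ p ∈ G.V, δ ≤ degree G p := by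
    refine ⟨⌊2.85 * Real.sqrt k⌋₊ + 1, ?_, ?_, fun p hp => ?_⟩
    · have : 6 ≤ ⌊2.85 * Real.sqrt k⌋₊ := Nat.le_floor (by push_cast; nlinarith)
      omega
    · have h1 := Nat.lt_floor_add_one (2.85 * Real.sqrt k)
      have : (8 * k : ℝ) < (⌊2.85 * Real.sqrt k⌋₊ + 1 : ℝ) ^ 2 := by nlinarith
      exact_mod_cast this
    · exact Nat.succ_le_of_lt ((Nat.floor_lt (by positivity)).2 (hcon p hp))
  obtain ⟨key, hinj, hori⟩ := G.convexPos.exists_key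
  obtain ⟨v, hv, hsurj, hmono⟩ := G.V.exists_enum_of_injOn hinj
  have vinj : ∀ i < G.V.card, ∀ j < G.V.card, v i = v j → i = j := by
    intro i hi j hj h
    rcases lt_trichotomy i j with hij | hij | hij
    · exact absurd (hmono i hi j hj hij) (by simp [h])
    · exact hij
    · exact absurd (hmono j hj i hi hij) (by simp [h])
  have hcross : ∀ a c b d, a < c → c < b → b < d → d < G.V.card →
      (openSegment ℝ (v a) (v b) ∩ openSegment ℝ (v c) (v d)).Nonempty := by
    intro a c b d hac hcb hbd hd
    have tri : ∀ x y z, x < y → y < z → z < G.V.card → 0 < orient (v x) (v y) (v z) :=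
      fun x y z hxy hyz hz => hori _ (hv x (by omega)) _ (hv y (by omega)) _ (hv z hz)
        (hmono x (by omega) y (by omega) hxy) (hmono y (by omega) z hz hyz)
    exact openSegment_inter_of_orient_pos (tri a c b hac hcb (by omega))
      (tri a b d (by omega) hbd hd) (tri a c d hac (by omega) hd) (tri c b d hcb hbd hd)
  obtain ⟨i, j, hij, hj, hadj, hcount⟩ := exists_edge_many_interleaving
    (n := G.V.card) (δ := δ) (d := δ / 3) hne.card_pos (by omega)
    (fun i j => s(v i, v j) ∈ G.E)
    (fun i h => G.not_diag _ h (by simp))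
    (by
      intro i hi
      refine (hδ _ (hv i hi)).trans ?_
      have hsub : G.E.filter (fun e => v i ∈ e) ⊆
          ((Finset.range G.V.card).filter fun j => s(v i, v j) ∈ G.E).image
            fun j => s(v i, v j) := by
        intro e he
        obtain ⟨heE, q, rfl⟩ := Finset.mem_filter.1 he
        obtain ⟨j, hj, rfl⟩ := hsurj q (G.mem_V _ heE q (by simp))
        exact Finset.mem_image_of_mem _ (by simp [hj, heE])
      exact (Finset.card_le_card hsub).trans
        (Finset.card_image_le.trans (le_of_eq (by congr))))
  have hle := hG _ hadj
  refine absurd ((lt_sum_of_eight_mul_lt_sq hδ7 hδk).trans_le hcount) (not_lt.2 (le_trans ?_ hle))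
  refine Finset.card_le_card_of_injOn (fun q => s(v q.1, v q.2)) ?_ ?_
  · rintro ⟨x, y⟩ hq
    simp only [Finset.coe_sigma, Set.mem_sigma_iff, Finset.mem_coe, Finset.mem_Ioo,
      Finset.mem_filter, Finset.mem_range] at hq
    obtain ⟨⟨hix, hxj⟩, hy, hxy, hout⟩ := hq
    simp only [Finset.coe_filter, Set.mem_ofPred_eq]
    refine ⟨hxy, fun h => ?_, ?_⟩
    · rcases Sym2.eq_iff.1 h with ⟨h1, -⟩ | ⟨-, h1⟩
      · have := vinj _ (by omega) _ (by omega) h1; omega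
      · have := vinj _ (by omega) _ (by omega) h1; omega
    · simp only [edgeSeg, Sym2.lift_mk]
      rcases hout with hout | hout
      · rw [Set.inter_comm, openSegment_symm ℝ (v x)]
        exact hcross y i x j hout hix hxj hj
      · exact hcross i x j y hix hxj hout hy
  · rintro ⟨x, y⟩ hq ⟨x', y'⟩ hq' h
    simp only [Finset.coe_sigma, Set.mem_sigma_iff, Finset.mem_coe, Finset.mem_Ioo,
      Finset.mem_filter, Finset.mem_range] at hq hq'
    rcases Sym2.eq_iff.1 h with ⟨h1, h2⟩ | ⟨h1, -⟩
    · obtain rfl : x = x' := vinj x (by omega) x' (by omega) h1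
      obtain rfl : y = y' := vinj y (by omega) y' (by omega) h2
      rfl
    · have : x = y' := vinj x (by omega) y' (by omega) h1
      omega

/-- The graph obtained by removing a vertex and its incident edges. -/
noncomputable def ConvexGeomGraph.deleteVertex (G : ConvexGeomGraph) (p : Pt) :
    ConvexGeomGraph where
  V := G.V.erase p
  E := G.E.filter fun e => p ∉ e
  convexPos := G.convexPos.subset (Finset.erase_subset _ _)
  not_diag e he := G.not_diag e (Finset.mem_of_mem_filter e he)
  mem_V e he q hq := by
    rw [Finset.mem_filter] at he
    exact Finset.mem_erase.2 ⟨fun h => he.2 (h ▸ hq), G.mem_V e he.1 q hq⟩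

theorem OuterKPlanar.deleteVertex {k : ℕ} {G : ConvexGeomGraph} (hG : OuterKPlanar G k) (p : Pt) :
    OuterKPlanar (G.deleteVertex p) k := fun e he =>
  (Finset.card_le_card (Finset.filter_subset_filter _ (Finset.filter_subset _ _))).trans
    (hG e (Finset.mem_of_mem_filter e he))

theorem ConvexGeomGraph.degree_add_card_deleteVertex (G : ConvexGeomGraph) (p : Pt) :
    degree G p + (G.deleteVertex p).E.card = G.E.card :=
  Finset.card_filter_add_card_filter_not _

/-- For every k ≥ 5, every outer k-planar graph on n vertices has
at most 2.85·√k·n edges. -/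
theorem stmt1 (k : ℕ) (hk : 5 ≤ k) (G : ConvexGeomGraph) (hG : OuterKPlanar G k) :
    (G.E.card : ℝ) ≤ 2.85 * Real.sqrt k * G.V.card := by
  induction hn : G.V.card generalizing G with
  | zero =>
    have hE : G.E = ∅ := by
      refine Finset.eq_empty_of_forall_notMem fun e he => ?_
      have := G.mem_V e he e.out.1 (Sym2.out_fst_mem e)
      simp [Finset.card_eq_zero.1 hn] at this
    simp [hE]
  | succ n ih =>
    obtain ⟨p, hp, hdeg⟩ := hG.exists_degree_le hk (Finset.card_pos.1 (by omega))
    have hcard : (G.deleteVertex p).V.card = n := by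
      simp [ConvexGeomGraph.deleteVertex, Finset.card_erase_of_mem hp, hn]
    have h := ih (G.deleteVertex p) (hG.deleteVertex p) hcard
    rw [← G.degree_add_card_deleteVertex p]
    push_cast
    linarith
end

section
/- Let V be a set of n points in ℝ² in convex position and E a set of m edges (straight-line segments between pairs of points of V) with m ≥ (171/40)·n. Then the number of unordered pairs of distinct edges of E that cross is at least (8000/87723)·m³/n². -/
open scoped Classical

namespace ConvexCrossing

open Finset

/-- Two pairs `i < j` and `k < l` of positions on a convex curve interleave, so that the
corresponding chords cross. -/
def Interleave (e f : ℕ × ℕ) : Prop :=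
  (e.1 < f.1 ∧ f.1 < e.2 ∧ e.2 < f.2) ∨ (f.1 < e.1 ∧ e.1 < f.2 ∧ f.2 < e.2)

theorem Interleave.symm {e f : ℕ × ℕ} (h : Interleave e f) : Interleave f e := Or.symm h

/-- The edges of `G` crossing the chord `(u, v)`. -/
noncomputable def crossers (G : Finset (ℕ × ℕ)) (u v : ℕ) : Finset (ℕ × ℕ) :=
  G.filter (Interleave (u, v))

theorem card_crossers (G : Finset (ℕ × ℕ)) (u v : ℕ) :
    (crossers G u v).card = (G.filter fun e => (u < e.1 ∧ e.1 < v ∧ v < e.2) ∨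
      (e.1 < u ∧ u < e.2 ∧ e.2 < v)).card := by
  unfold crossers Interleave
  congr

/-- The number of edges crossing the chord `(u, v)` whose endpoint between `u` and `v` lies
strictly between `x` and `y`. -/
noncomputable def crossersIn (G : Finset (ℕ × ℕ)) (u v x y : ℕ) : ℕ :=
  (G.filter fun e => (x < e.1 ∧ e.1 < y ∧ v < e.2) ∨ (e.1 < u ∧ x < e.2 ∧ e.2 < y)).card

theorem crossersIn_self (G : Finset (ℕ × ℕ)) (u v : ℕ) :
    crossersIn G u v u v = (crossers G u v).card := by
  rw [card_crossers, crossersIn]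

section CardFilter

variable {α : Type*} {s : Finset α} {p q r t : α → Prop}
  [DecidablePred p] [DecidablePred q] [DecidablePred r] [DecidablePred t]

theorem card_filter_add_le (hp : ∀ a ∈ s, p a → r a) (hq : ∀ a ∈ s, q a → r a)
    (hpq : ∀ a ∈ s, p a → ¬ q a) :
    (s.filter p).card + (s.filter q).card ≤ (s.filter r).card := by
  rw [← card_union_of_disjoint (disjoint_filter.2 hpq), ← filter_or]
  refine card_le_card fun a ha => ?_
  simp only [mem_filter] at ha ⊢
  exact ⟨ha.1, ha.2.elim (hp a ha.1) (hq a ha.1)⟩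

theorem card_filter_le_add (h : ∀ a ∈ s, r a → p a ∨ q a) :
    (s.filter r).card ≤ (s.filter p).card + (s.filter q).card := by
  refine le_trans (card_le_card fun a ha => ?_) (card_union_le _ _)
  simp only [mem_filter, mem_union] at ha ⊢
  exact (h a ha.1 ha.2).imp (⟨ha.1, ·⟩) (⟨ha.1, ·⟩)

theorem card_filter_add_add_le (hp : ∀ a ∈ s, p a → r a) (hq : ∀ a ∈ s, q a → r a)
    (ht : ∀ a ∈ s, t a → r a) (hpq : ∀ a ∈ s, p a → ¬ q a) (hpt : ∀ a ∈ s, p a → ¬ t a)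
    (hqt : ∀ a ∈ s, q a → ¬ t a) :
    (s.filter p).card + (s.filter q).card + (s.filter t).card ≤ (s.filter r).card := by
  refine le_trans (Nat.add_le_add_right (card_filter_add_le (r := fun a => p a ∨ q a)
    (fun a _ h => Or.inl h) (fun a _ h => Or.inr h) hpq) _) ?_
  exact card_filter_add_le (fun a ha h => h.elim (hp a ha) (hq a ha)) ht
    (fun a ha h => h.elim (hpt a ha) (hqt a ha))

end CardFilter

variable {G : Finset (ℕ × ℕ)}

theorem crossersIn_split (hG : ∀ e ∈ G, e.1 < e.2) {u v x y z : ℕ} (hu : u ≤ x) (hv : z ≤ v)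
    (hxy : x < y) (hyz : y < z) :
    crossersIn G u v x y + crossersIn G u v (y - 1) (y + 1) + crossersIn G u v y z
      = crossersIn G u v x z := by
  unfold crossersIn
  refine le_antisymm (card_filter_add_add_le ?_ ?_ ?_ ?_ ?_ ?_) ?_
  any_goals intro e he; have := hG e he; omega
  refine le_trans (card_filter_le_add (p := fun e => ((x < e.1 ∧ e.1 < y + 1 ∧ v < e.2) ∨
    (e.1 < u ∧ x < e.2 ∧ e.2 < y + 1))) ?_) (Nat.add_le_add_right (card_filter_le_add ?_) _)
  all_goals intro e he; have := hG e he; omega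

theorem exists_far_right (G : Finset (ℕ × ℕ)) {u v : ℕ} (huv : u + 1 < v) :
    ∃ d, u < d ∧ d < v ∧ (d = u + 1 ∨ (u, d) ∈ G) ∧ ∀ d', d < d' → d' < v → (u, d') ∉ G := by
  have hne : ((Ioo u v).filter fun d => d = u + 1 ∨ (u, d) ∈ G).Nonempty :=
    ⟨u + 1, by simp; omega⟩
  obtain ⟨d, hd, hmax⟩ := exists_max_image _ id hne
  simp only [mem_filter, mem_Ioo, id] at hd hmax
  refine ⟨d, hd.1.1, hd.1.2, hd.2, fun d' h1 h2 h3 => ?_⟩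
  have := hmax d' ⟨⟨by omega, h2⟩, Or.inr h3⟩
  omega

theorem exists_far_left (G : Finset (ℕ × ℕ)) {u v : ℕ} (huv : u + 1 < v) :
    ∃ c, u < c ∧ c < v ∧ (c + 1 = v ∨ (c, v) ∈ G) ∧ ∀ c', u < c' → c' < c → (c', v) ∉ G := by
  have hne : ((Ioo u v).filter fun c => c + 1 = v ∨ (c, v) ∈ G).Nonempty :=
    ⟨v - 1, by simp; omega⟩
  obtain ⟨c, hc, hmin⟩ := exists_min_image _ id hne
  simp only [mem_filter, mem_Ioo, id] at hc hmin
  refine ⟨c, hc.1.1, hc.1.2, hc.2, fun c' h1 h2 h3 => ?_⟩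
  have := hmin c' ⟨⟨h1, by omega⟩, Or.inr h3⟩
  omega

theorem card_crossers_succ (hG : ∀ e ∈ G, e.1 < e.2) (u : ℕ) :
    (crossers G u (u + 1)).card = 0 := by
  rw [card_crossers, card_eq_zero, filter_eq_empty_iff]
  intro e he; have := hG e he; omega

set_option maxHeartbeats 1000000 in
/-- If every edge is crossed at most four times, then a chord crossed at most four times can be
completed to a triangle on either side by chords crossed at most four times. -/
theorem exists_apex (hG : ∀ e ∈ G, e.1 < e.2) (h4 : ∀ e ∈ G, (crossers G e.1 e.2).card ≤ 4)
    {u v : ℕ} (huv : u + 1 < v) (hk : (crossers G u v).card ≤ 4) :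
    ∃ w, u < w ∧ w < v ∧ (crossers G u w).card ≤ 4 ∧ (crossers G w v).card ≤ 4 := by
  obtain ⟨d, hud, hdv, hd, hdmax⟩ := exists_far_right G huv
  obtain ⟨c, huc, hcv, hc, hcmin⟩ := exists_far_left G huv
  have hfd : (crossers G u d).card ≤ 4 := by
    rcases hd with rfl | hd
    · rw [card_crossers_succ hG]; omega
    · exact h4 _ hd
  have hgc : (crossers G c v).card ≤ 4 := by
    rcases hc with rfl | hc
    · rw [card_crossers_succ hG]; omega
    · exact h4 _ hc
  by_contra! hno
  have hgd := hno d hud hdv hfd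
  have hfc : 4 < (crossers G u c).card := by
    by_contra! h
    have := hno c huc hcv h
    omega
  have mem_ne : ∀ e ∈ G, ∀ x y, (x, y) ∉ G → ¬ (e.1 = x ∧ e.2 = y) := by
    rintro ⟨a, b⟩ he x y hxy ⟨rfl, rfl⟩; exact hxy he
  have hσ := crossersIn_self G u v
  have hd_lt : crossersIn G u v u d < crossersIn G u v d v := by
    have h1 : (crossers G d v).card ≤ crossersIn G u v d v +
        (G.filter fun e => u < e.1 ∧ e.1 < d ∧ d < e.2 ∧ e.2 < v).card := by
      rw [card_crossers]
      unfold crossersIn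
      refine card_filter_le_add ?_
      intro e he h
      have := hG e he
      have : ¬ (e.1 = u ∧ d < e.2 ∧ e.2 < v) := fun h =>
        mem_ne e he _ _ (hdmax e.2 h.2.1 h.2.2) ⟨h.1, rfl⟩
      omega
    have h2 : crossersIn G u v u d +
        (G.filter fun e => u < e.1 ∧ e.1 < d ∧ d < e.2 ∧ e.2 < v).card
          ≤ (crossers G u d).card := by
      rw [card_crossers]
      unfold crossersIn
      refine card_filter_add_le ?_ ?_ ?_ <;> intro e he <;> have := hG e he <;> omega
    omega
  have hc_lt : crossersIn G u v c v < crossersIn G u v u c := by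
    have h1 : (crossers G u c).card ≤ crossersIn G u v u c +
        (G.filter fun e => u < e.1 ∧ e.1 < c ∧ c < e.2 ∧ e.2 < v).card := by
      rw [card_crossers]
      unfold crossersIn
      refine card_filter_le_add ?_
      intro e he h
      have := hG e he
      have : ¬ (e.2 = v ∧ u < e.1 ∧ e.1 < c) := fun h =>
        mem_ne e he _ _ (hcmin e.1 h.2.1 h.2.2) ⟨rfl, h.1⟩
      omega
    have h2 : crossersIn G u v c v +
        (G.filter fun e => u < e.1 ∧ e.1 < c ∧ c < e.2 ∧ e.2 < v).card
          ≤ (crossers G c v).card := by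
      rw [card_crossers]
      unfold crossersIn
      refine card_filter_add_le ?_ ?_ ?_ <;> intro e he <;> have := hG e he <;> omega
    omega
  -- the median crossing edge ends at `b`
  obtain ⟨b, hub, hbv, hb1, hb2⟩ : ∃ b, u < b ∧ b < v ∧
      2 * crossersIn G u v u b < (crossers G u v).card ∧
      (crossers G u v).card ≤ 2 * crossersIn G u v u (b + 1) := by
    have hex : ∃ b, (crossers G u v).card ≤ 2 * crossersIn G u v u (b + 1) := by
      refine ⟨v - 1, ?_⟩
      rw [Nat.sub_add_cancel (by omega), hσ]; omega
    have hpos : 0 < (crossers G u v).card := by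
      have := crossersIn_split hG le_rfl le_rfl hud hdv
      omega
    have h0 : ∀ y ≤ u + 1, crossersIn G u v u y = 0 := by
      intro y hy
      rw [crossersIn, card_eq_zero, filter_eq_empty_iff]
      intro e he; omega
    have hs := Nat.find_spec hex
    have hm : ∀ m < Nat.find hex, _ := fun m hm => Nat.find_min hex hm
    have hle : Nat.find hex ≤ v - 1 := Nat.find_min' hex (by
      rw [Nat.sub_add_cancel (by omega), hσ]; omega)
    set b := Nat.find hex
    have hub : u < b := by
      by_contra! h
      have := h0 (b + 1) (by omega)
      omega
    refine ⟨b, hub, by omega, ?_, hs⟩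
    have := hm (b - 1) (by omega)
    rw [Nat.sub_add_cancel (by omega)] at this
    omega
  have mono : ∀ {x y x' y' : ℕ}, x' ≤ x → y ≤ y' →
      crossersIn G u v x y ≤ crossersIn G u v x' y' := by
    intro x y x' y' hx hy
    refine card_le_card fun e => ?_
    simp only [mem_filter]
    rintro ⟨he, h⟩
    exact ⟨he, by omega⟩
  have split_d := crossersIn_split hG le_rfl le_rfl hud hdv
  have split_c := crossersIn_split hG le_rfl le_rfl huc hcv
  have split_b := crossersIn_split hG le_rfl le_rfl hub hbv
  have split_b' : crossersIn G u v u (b + 1) ≤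
      crossersIn G u v u b + crossersIn G u v (b - 1) (b + 1) := by
    unfold crossersIn
    refine card_filter_le_add ?_
    intro e he; omega
  have hdb : d ≤ b := by
    by_contra! h
    have := mono (le_refl u) (show b + 1 ≤ d by omega)
    omega
  have hbc : b ≤ c := by
    by_contra! h
    have h1 := mono (le_refl u) (show c + 1 ≤ b by omega)
    have h2 : crossersIn G u v u c + crossersIn G u v (c - 1) (c + 1) ≤
        crossersIn G u v u (c + 1) := by
      unfold crossersIn
      refine card_filter_add_le ?_ ?_ ?_ <;> intro e he <;> have := hG e he <;> omega
    omega
  have no_u : ∀ e ∈ G, ¬ (e.1 = u ∧ b < e.2 ∧ e.2 < v) := fun e he h =>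
    mem_ne e he _ _ (hdmax e.2 (by omega) h.2.2) ⟨h.1, rfl⟩
  have no_v : ∀ e ∈ G, ¬ (e.2 = v ∧ u < e.1 ∧ e.1 < b) := fun e he h =>
    mem_ne e he _ _ (hcmin e.1 h.2.1 (by omega)) ⟨rfl, h.1⟩
  rcases (G.filter fun e => u < e.1 ∧ e.1 < b ∧ b < e.2 ∧ e.2 < v).eq_empty_or_nonempty
    with hZ | hZ
  · rw [filter_eq_empty_iff] at hZ
    have h1 : (crossers G u b).card ≤ crossersIn G u v u b := by
      rw [card_crossers]
      refine card_le_card fun e => ?_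
      simp only [mem_filter]
      rintro ⟨he, h⟩
      have := hG e he; have := hZ he; have := no_v e he
      exact ⟨he, by omega⟩
    have h2 : (crossers G b v).card ≤ crossersIn G u v b v := by
      rw [card_crossers]
      refine card_le_card fun e => ?_
      simp only [mem_filter]
      rintro ⟨he, h⟩
      have := hG e he; have := hZ he; have := no_u e he
      exact ⟨he, by omega⟩
    have := hno b hub hbv (by omega)
    omega
  · obtain ⟨⟨p, q⟩, hpq, hmax⟩ := exists_max_image _ (fun e => e.2 - e.1) hZ
    simp only [mem_filter] at hpq hmax
    obtain ⟨hpqG, hup, hpb, hbq, hqv⟩ := hpq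
    have hlong : ∀ e ∈ G, ¬ (u < e.1 ∧ e.1 ≤ p ∧ q ≤ e.2 ∧ e.2 < v ∧ e.2 - e.1 ≠ q - p) := by
      intro e he h
      have := hmax e ⟨he, by omega⟩
      omega
    have hX := h4 _ hpqG
    set l := (G.filter fun e => u ≤ e.1 ∧ e.1 < p ∧ p < e.2 ∧ e.2 < q).card with hl
    set r := (G.filter fun e => p < e.1 ∧ e.1 < q ∧ q < e.2 ∧ e.2 ≤ v).card with hr
    have hlr : l + r + crossersIn G u v p q ≤ 4 := by
      refine le_trans ?_ hX
      rw [card_crossers]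
      unfold crossersIn
      refine card_filter_add_add_le ?_ ?_ ?_ ?_ ?_ ?_ <;> intro e he <;> have := hG e he <;>
        omega
    have hfp : (crossers G u p).card ≤ crossersIn G u v u p + l := by
      rw [card_crossers]
      unfold crossersIn
      refine card_filter_le_add fun e he h => ?_
      have := hG e he; have := hlong e he; have := no_v e he
      omega
    have hgp : (crossers G p v).card ≤ crossersIn G u v p v + l := by
      rw [card_crossers]
      unfold crossersIn
      refine card_filter_le_add fun e he h => ?_
      have := hG e he; have := hlong e he; have := no_u e he
      omega
    have hfq : (crossers G u q).card ≤ crossersIn G u v u q + r := by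
      rw [card_crossers]
      unfold crossersIn
      refine card_filter_le_add fun e he h => ?_
      have := hG e he; have := hlong e he; have := no_v e he
      omega
    have hgq : (crossers G q v).card ≤ crossersIn G u v q v + r := by
      rw [card_crossers]
      unfold crossersIn
      refine card_filter_le_add fun e he h => ?_
      have := hG e he; have := hlong e he; have := no_u e he
      omega
    have split_p := crossersIn_split hG le_rfl le_rfl hup (show p < v by omega)
    have split_q := crossersIn_split hG le_rfl le_rfl (show u < q by omega) hqv
    have split_pq := crossersIn_split hG hup.le le_rfl (show p < q by omega) hqv
    have hb3 := mono (x := b - 1) (y := b + 1) (x' := p) (y' := q) (by omega) (by omega)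
    have hb4 := mono (le_refl u) hpb.le
    have hb5 := mono hbq.le (le_refl v)
    have h1 := hno p hup (by omega)
    have h2 := hno q (by omega) hqv
    by_cases h3 : (crossers G u p).card ≤ 4
    · have := h1 h3
      by_cases h4 : (crossers G u q).card ≤ 4
      · have := h2 h4
        omega
      · omega
    · by_cases h4 : (crossers G u q).card ≤ 4
      · have := h2 h4
        omega
      · omega

/-- The number of edges of `G` with both endpoints between `u` and `v`. -/
noncomputable def inside (G : Finset (ℕ × ℕ)) (u v : ℕ) : ℕ :=
  (G.filter fun e => u ≤ e.1 ∧ e.2 ≤ v).card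

/-- The number of ordered pairs of crossing edges, one of which has both endpoints between `u`
and `v`. -/
noncomputable def insideCrossings (G : Finset (ℕ × ℕ)) (u v : ℕ) : ℕ :=
  ((G ×ˢ G).filter fun p => Interleave p.1 p.2 ∧
    ((u ≤ p.1.1 ∧ p.1.2 ≤ v) ∨ (u ≤ p.2.1 ∧ p.2.2 ≤ v))).card

/-- The endpoint between `u` and `v` of an edge crossing the chord `(u, v)`. -/
noncomputable def innerEnd (u v : ℕ) (e : ℕ × ℕ) : ℕ := if u < e.1 ∧ e.1 < v then e.1 else e.2

/-- The endpoints between `u` and `v` of the edges crossing the chord `(u, v)`. -/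
noncomputable def innerEnds (G : Finset (ℕ × ℕ)) (u v : ℕ) : Finset ℕ :=
  (crossers G u v).image (innerEnd u v)

/-- The gain in the bound for the arc between `u` and `v` when `(u, v)` is crossed by `k` edges
with `r` distinct endpoints on the arc. -/
def gain : ℕ → ℕ → ℕ
  | 0, _ => 0
  | _, 0 => 0
  | 1, _ => 16
  | _, 1 => 17
  | 2, _ => 26
  | 3, 2 => 30
  | 3, _ => 35
  | 4, 2 => 34
  | 4, 3 => 43
  | 4, _ => 60
  | _, _ => 0

theorem gain_mono : ∀ k < 5, ∀ r' < 5, ∀ r < r' + 1, gain k r ≤ gain k r' := by decide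

/-- The inequality behind the inductive step of the arc bound. -/
def GainStep (a m p b q x r s : ℕ) : Prop :=
  a ≤ r ∧ b ≤ s ∧ min 1 (a + m + p) ≤ r ∧ min 1 (b + m + q) ≤ s ∧ m ≤ r * s →
    40 + 20 * (a + b + m) + gain (p + q + x) (min p r + min q s + min x 1) ≤
      57 + gain (a + m + p) r + gain (b + m + q) s + 4 * (a + m + p) + 4 * (b + m + q) +
        4 * (b * (p + x) + a * (q + x + b) + m * x)

instance (a m p b q x r s : ℕ) : Decidable (GainStep a m p b q x r s) := by
  unfold GainStep
  infer_instance

/-- `GainStep` for all admissible values of the last three parameters. -/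
def GainSteps (a m p b q : ℕ) : Prop :=
  ∀ x < 5 - p - q, ∀ r < a + m + p + 1, ∀ s < b + m + q + 1, GainStep a m p b q x r s

instance (a m p b q : ℕ) : Decidable (GainSteps a m p b q) := by
  unfold GainSteps
  infer_instance

theorem gainSteps : ∀ a < 5, ∀ m < 5 - a, ∀ p < 5 - a - m, ∀ b < 5 - m, ∀ q < 5 - m - b,
    GainSteps a m p b q := by
  decide +kernel

theorem gainStep_of_le {a m p b q x r s t : ℕ} (hL : a + m + p ≤ 4) (hR : b + m + q ≤ 4)
    (hk : p + q + x ≤ 4) (har : a ≤ r) (hr : r ≤ a + m + p) (hbs : b ≤ s) (hs : s ≤ b + m + q)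
    (hr0 : 0 < a + m + p → 0 < r) (hs0 : 0 < b + m + q → 0 < s) (hm : m ≤ r * s)
    (ht : t ≤ min p r + min q s + min x 1) :
    40 + 20 * (a + b + m) + gain (p + q + x) t ≤
      57 + gain (a + m + p) r + gain (b + m + q) s + 4 * (a + m + p) + 4 * (b + m + q) +
        4 * (b * (p + x) + a * (q + x + b) + m * x) := by
  have h1 := gainSteps a (by omega) m (by omega) p (by omega) b (by omega) q (by omega)
    x (by omega) r (by omega) s (by omega) ⟨har, hbs, by omega, by omega, hm⟩
  have h2 := gain_mono (p + q + x) (by omega) (min p r + min q s + min x 1) (by omega) t (by omega)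
  omega

theorem card_filter_eq_add {α : Type*} {s : Finset α} {p q r : α → Prop}
    [DecidablePred p] [DecidablePred q] [DecidablePred r]
    (h : ∀ a ∈ s, r a ↔ p a ∨ q a) (hpq : ∀ a ∈ s, p a → ¬ q a) :
    (s.filter r).card = (s.filter p).card + (s.filter q).card :=
  le_antisymm (card_filter_le_add fun a ha => (h a ha).1)
    (card_filter_add_le (fun a ha hp => (h a ha).2 (Or.inl hp))
      (fun a ha hq => (h a ha).2 (Or.inr hq)) hpq)

theorem card_filter_prod (G : Finset (ℕ × ℕ)) (p q : ℕ × ℕ → Prop)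
    [DecidablePred p] [DecidablePred q] :
    ((G ×ˢ G).filter fun x => p x.1 ∧ q x.2).card = (G.filter p).card * (G.filter q).card := by
  rw [← card_product, ← filter_product]

theorem card_filter_swap (G : Finset (ℕ × ℕ)) (p : (ℕ × ℕ) × (ℕ × ℕ) → Prop)
    [DecidablePred p] :
    ((G ×ˢ G).filter fun x => p x.swap).card = ((G ×ˢ G).filter p).card := by
  refine card_bij (fun x _ => x.swap) ?_ ?_ ?_
  · simp only [mem_filter, mem_product, Prod.fst_swap, Prod.snd_swap]
    exact fun x hx => ⟨hx.1.symm, hx.2⟩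
  · exact fun x _ y _ h => Prod.swap_injective h
  · simp only [mem_filter, mem_product]
    exact fun x hx => ⟨x.swap, ⟨hx.1.symm, by simpa using hx.2⟩, by simp⟩

section Merge

/-- Edges crossing `(u, w)` that end at `v`. -/
def EdgeL (u w v : ℕ) (e : ℕ × ℕ) : Prop := u < e.1 ∧ e.1 < w ∧ e.2 = v

/-- Edges crossing `(w, v)` that end at `u`. -/
def EdgeR (u w v : ℕ) (e : ℕ × ℕ) : Prop := e.1 = u ∧ w < e.2 ∧ e.2 < v

/-- Edges crossing both `(u, w)` and `(w, v)`. -/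
def EdgeM (u w v : ℕ) (e : ℕ × ℕ) : Prop := u < e.1 ∧ e.1 < w ∧ w < e.2 ∧ e.2 < v

/-- Edges crossing both `(u, w)` and `(u, v)`. -/
def PassL (u w v : ℕ) (e : ℕ × ℕ) : Prop :=
  (u < e.1 ∧ e.1 < w ∧ v < e.2) ∨ (e.1 < u ∧ u < e.2 ∧ e.2 < w)

/-- Edges crossing both `(w, v)` and `(u, v)`. -/
def PassR (u w v : ℕ) (e : ℕ × ℕ) : Prop :=
  (w < e.1 ∧ e.1 < v ∧ v < e.2) ∨ (e.1 < u ∧ w < e.2 ∧ e.2 < v)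

/-- Edges ending at `w` that cross `(u, v)`. -/
def EdgeX (u w v : ℕ) (e : ℕ × ℕ) : Prop := (e.1 = w ∧ v < e.2) ∨ (e.1 < u ∧ e.2 = w)

/-- Pairs of crossing edges that become relevant when two arcs are merged at `w`. -/
def MergePair (u w v : ℕ) (x : (ℕ × ℕ) × (ℕ × ℕ)) : Prop :=
  ((x.1.1 = u ∧ x.1.2 = v) ∧ Interleave (u, v) x.2) ∨
  (EdgeR u w v x.1 ∧ (PassL u w v x.2 ∨ EdgeX u w v x.2)) ∨
  (EdgeL u w v x.1 ∧ (PassR u w v x.2 ∨ EdgeX u w v x.2 ∨ EdgeR u w v x.2)) ∨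
  (EdgeM u w v x.1 ∧ EdgeX u w v x.2)

variable {u w v : ℕ}

theorem card_crossers_left (hG : ∀ e ∈ G, e.1 < e.2) (huw : u < w) (hwv : w < v) :
    (crossers G u w).card = (G.filter (EdgeL u w v)).card + (G.filter (EdgeM u w v)).card +
      (G.filter (PassL u w v)).card := by
  rw [crossers, card_filter_eq_add (p := fun e => EdgeL u w v e ∨ EdgeM u w v e)
    (q := PassL u w v), card_filter_eq_add (p := EdgeL u w v) (q := EdgeM u w v)]
  all_goals
    intro e he; have := hG e he
    simp only [Interleave, EdgeL, EdgeM, PassL] <;> omega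

theorem card_crossers_right (hG : ∀ e ∈ G, e.1 < e.2) (huw : u < w) (hwv : w < v) :
    (crossers G w v).card = (G.filter (EdgeR u w v)).card + (G.filter (EdgeM u w v)).card +
      (G.filter (PassR u w v)).card := by
  rw [crossers, card_filter_eq_add (p := fun e => EdgeR u w v e ∨ EdgeM u w v e)
    (q := PassR u w v), card_filter_eq_add (p := EdgeR u w v) (q := EdgeM u w v)]
  all_goals
    intro e he; have := hG e he
    simp only [Interleave, EdgeR, EdgeM, PassR] <;> omega

theorem card_crossers_merge (hG : ∀ e ∈ G, e.1 < e.2) (huw : u < w) (hwv : w < v) :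
    (crossers G u v).card = (G.filter (PassL u w v)).card + (G.filter (PassR u w v)).card +
      (G.filter (EdgeX u w v)).card := by
  rw [crossers, card_filter_eq_add (p := fun e => PassL u w v e ∨ PassR u w v e)
    (q := EdgeX u w v), card_filter_eq_add (p := PassL u w v) (q := PassR u w v)]
  all_goals
    intro e he; have := hG e he
    simp only [Interleave, PassL, PassR, EdgeX] <;> omega

theorem inside_merge (hG : ∀ e ∈ G, e.1 < e.2) (huw : u < w) (hwv : w < v) :
    inside G u v = inside G u w + inside G w v + ((G.filter (EdgeL u w v)).card +
      (G.filter (EdgeR u w v)).card + (G.filter (EdgeM u w v)).card) +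
      (G.filter fun e => e.1 = u ∧ e.2 = v).card := by
  unfold inside
  rw [card_filter_eq_add (p := fun e => (u ≤ e.1 ∧ e.2 ≤ w) ∨ (w ≤ e.1 ∧ e.2 ≤ v) ∨
      EdgeL u w v e ∨ EdgeR u w v e ∨ EdgeM u w v e) (q := fun e => e.1 = u ∧ e.2 = v),
    card_filter_eq_add (r := fun e => (u ≤ e.1 ∧ e.2 ≤ w) ∨ (w ≤ e.1 ∧ e.2 ≤ v) ∨
      EdgeL u w v e ∨ EdgeR u w v e ∨ EdgeM u w v e) fun _ _ => Iff.rfl,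
    card_filter_eq_add (r := fun e => (w ≤ e.1 ∧ e.2 ≤ v) ∨
      EdgeL u w v e ∨ EdgeR u w v e ∨ EdgeM u w v e) fun _ _ => Iff.rfl,
    card_filter_eq_add (r := fun e => EdgeL u w v e ∨ EdgeR u w v e ∨ EdgeM u w v e)
      fun _ _ => Iff.rfl,
    card_filter_eq_add (r := fun e => EdgeR u w v e ∨ EdgeM u w v e) fun _ _ => Iff.rfl]
  · omega
  all_goals
    intro e he; have := hG e he
    simp only [EdgeL, EdgeR, EdgeM]
    omega

theorem card_filter_mergePair (hG : ∀ e ∈ G, e.1 < e.2) (huw : u < w) :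
    ((G ×ˢ G).filter (MergePair u w v)).card =
      (G.filter fun e => e.1 = u ∧ e.2 = v).card * (crossers G u v).card +
      (G.filter (EdgeR u w v)).card *
        ((G.filter (PassL u w v)).card + (G.filter (EdgeX u w v)).card) +
      (G.filter (EdgeL u w v)).card *
        ((G.filter (PassR u w v)).card + (G.filter (EdgeX u w v)).card +
          (G.filter (EdgeR u w v)).card) +
      (G.filter (EdgeM u w v)).card * (G.filter (EdgeX u w v)).card := by
  have h1 : (G.filter fun e => PassL u w v e ∨ EdgeX u w v e).card =
      (G.filter (PassL u w v)).card + (G.filter (EdgeX u w v)).card := by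
    refine card_filter_eq_add (fun _ _ => Iff.rfl) ?_
    intro e he; have := hG e he
    simp only [PassL, EdgeX]
    omega
  have h2 : (G.filter fun e => PassR u w v e ∨ EdgeX u w v e ∨ EdgeR u w v e).card =
      (G.filter (PassR u w v)).card + (G.filter (EdgeX u w v)).card +
        (G.filter (EdgeR u w v)).card := by
    rw [card_filter_eq_add fun _ _ => Iff.rfl, card_filter_eq_add
      (r := fun e => EdgeX u w v e ∨ EdgeR u w v e) fun _ _ => Iff.rfl, add_assoc]
    all_goals
      intro e he; have := hG e he
      simp only [PassR, EdgeX, EdgeR]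
      omega
  rw [crossers, ← h1, ← h2, ← card_filter_prod, ← card_filter_prod, ← card_filter_prod,
    ← card_filter_prod, add_assoc, add_assoc]
  rw [card_filter_eq_add (r := MergePair u w v) fun _ _ => Iff.rfl, card_filter_eq_add fun _ _ => Iff.rfl,
    card_filter_eq_add fun _ _ => Iff.rfl]
  all_goals
    simp only [EdgeR, EdgeL, EdgeM]
    omega

set_option maxHeartbeats 1000000 in
theorem insideCrossings_merge (hG : ∀ e ∈ G, e.1 < e.2) (huw : u < w) (hwv : w < v) :
    insideCrossings G u w + insideCrossings G w v + 2 * ((G ×ˢ G).filter (MergePair u w v)).card ≤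
      insideCrossings G u v := by
  have hT : ∀ e ∈ G, ∀ f ∈ G, MergePair u w v (e, f) → Interleave e f ∧ u ≤ e.1 ∧ e.2 ≤ v ∧
      ¬ (u ≤ f.1 ∧ f.2 ≤ w) ∧ ¬ (w ≤ f.1 ∧ f.2 ≤ v) ∧ ¬ (u ≤ e.1 ∧ e.2 ≤ w) ∧
      ¬ (w ≤ e.1 ∧ e.2 ≤ v) ∧ (u ≤ f.1 ∧ f.2 ≤ v → f.1 = u ∧ u < e.1) := by
    intro e he f hf
    have := hG e he; have := hG f hf
    simp only [MergePair, EdgeL, EdgeR, EdgeM, PassL, PassR, EdgeX, Interleave]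
    rintro (h | h | h | h) <;> omega
  rw [two_mul]
  nth_rewrite 2 [← card_filter_swap]
  rw [← add_assoc]
  unfold insideCrossings
  refine le_trans (Nat.add_le_add_right (card_filter_add_add_le (r := fun x =>
    (Interleave x.1 x.2 ∧ ((u ≤ x.1.1 ∧ x.1.2 ≤ w) ∨ (u ≤ x.2.1 ∧ x.2.2 ≤ w))) ∨
    (Interleave x.1 x.2 ∧ ((w ≤ x.1.1 ∧ x.1.2 ≤ v) ∨ (w ≤ x.2.1 ∧ x.2.2 ≤ v))) ∨
    MergePair u w v x) ?_ ?_ ?_ ?_ ?_ ?_) _) (card_filter_add_le ?_ ?_ ?_)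
  · exact fun _ _ h => Or.inl h
  · exact fun _ _ h => Or.inr (Or.inl h)
  · exact fun _ _ h => Or.inr (Or.inr h)
  all_goals
    rintro ⟨e, f⟩ hx
    obtain ⟨he, hf⟩ := mem_product.1 hx
    have h1 := hG e he; have h2 := hG f hf
    have h3 := hT e he f hf
    have h4 := hT f hf e he
    simp only [Prod.swap, Interleave] at he hf h1 h2 h3 h4 ⊢
  · omega
  · intro h5 h6; have := h3 h6; omega
  · intro h5 h6; have := h3 h6; omega
  · rintro (h5 | h5 | h5)
    · omega
    · omega
    · have := h3 h5; omega
  · intro h5; have := h4 h5; omega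
  · intro h5 h6; have := h4 h6
    rcases h5 with h5 | h5 | h5
    · omega
    · omega
    · have := h3 h5; omega

end Merge

theorem card_innerEnds_le (G : Finset (ℕ × ℕ)) (u v : ℕ) :
    (innerEnds G u v).card ≤ (crossers G u v).card := card_image_le

theorem card_innerEnds_pos {u v : ℕ} (h : 0 < (crossers G u v).card) :
    0 < (innerEnds G u v).card :=
  card_pos.2 ((card_pos.1 h).image _)

section MergeEnds

variable {u w v : ℕ}

theorem card_edgeL_le (huw : u < w) (hwv : w < v) :
    (G.filter (EdgeL u w v)).card ≤ (innerEnds G u w).card := by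
  refine card_le_card_of_injOn (innerEnd u w) ?_ ?_
  · intro e he
    simp only [coe_filter, Set.mem_ofPred_eq, EdgeL] at he
    refine mem_image_of_mem _ (mem_filter.2 ⟨he.1, ?_⟩)
    simp only [Interleave]; omega
  · rintro ⟨a, b⟩ he ⟨c, d⟩ hf h
    simp only [coe_filter, Set.mem_ofPred_eq, EdgeL] at he hf
    simp only [innerEnd, he.2.1, he.2.2.1, hf.2.1, hf.2.2.1, and_self, if_true] at h
    rw [h, he.2.2.2, hf.2.2.2]

theorem card_edgeR_le (huw : u < w) :
    (G.filter (EdgeR u w v)).card ≤ (innerEnds G w v).card := by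
  refine card_le_card_of_injOn (innerEnd w v) ?_ ?_
  · intro e he
    simp only [coe_filter, Set.mem_ofPred_eq, EdgeR] at he
    refine mem_image_of_mem _ (mem_filter.2 ⟨he.1, ?_⟩)
    simp only [Interleave]; omega
  · rintro ⟨a, b⟩ he ⟨c, d⟩ hf h
    simp only [coe_filter, Set.mem_ofPred_eq, EdgeR] at he hf
    obtain ⟨-, rfl, h1⟩ := he
    obtain ⟨-, rfl, h2⟩ := hf
    simp only [innerEnd, huw.not_gt, false_and, if_false] at h
    rw [h]

theorem card_edgeM_le :
    (G.filter (EdgeM u w v)).card ≤ (innerEnds G u w).card * (innerEnds G w v).card := by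
  rw [← card_product]
  refine card_le_card fun e he => ?_
  simp only [mem_filter, EdgeM] at he
  refine mem_product.2 ⟨mem_image.2 ⟨e, mem_filter.2 ⟨he.1, ?_⟩, ?_⟩,
    mem_image.2 ⟨e, mem_filter.2 ⟨he.1, ?_⟩, ?_⟩⟩
  · simp only [Interleave]; omega
  · rw [innerEnd, if_pos ⟨he.2.1, he.2.2.1⟩]
  · simp only [Interleave]; omega
  · rw [innerEnd, if_neg (by omega)]

theorem card_innerEnds_merge (hG : ∀ e ∈ G, e.1 < e.2) (huw : u < w) (hwv : w < v) :
    (innerEnds G u v).card ≤ min (G.filter (PassL u w v)).card (innerEnds G u w).card +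
      min (G.filter (PassR u w v)).card (innerEnds G w v).card +
      min (G.filter (EdgeX u w v)).card 1 := by
  have hsub : innerEnds G u v ⊆ (G.filter (PassL u w v)).image (innerEnd u v) ∪
      (G.filter (PassR u w v)).image (innerEnd u v) ∪
      (G.filter (EdgeX u w v)).image (innerEnd u v) := by
    rw [← image_union, ← image_union]
    refine image_subset_image fun e he => ?_
    simp only [crossers, mem_filter, mem_union, Interleave, PassL, PassR, EdgeX] at he ⊢
    have := hG e he.1
    simp only [he.1, true_and]
    omega
  refine (card_le_card hsub).trans ((card_union_le _ _).trans (add_le_add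
    ((card_union_le _ _).trans (add_le_add ?_ ?_)) ?_)) <;>
  refine le_min card_image_le ?_
  · refine card_le_card fun y hy => ?_
    obtain ⟨e, he, rfl⟩ := mem_image.1 hy
    simp only [mem_filter, PassL] at he
    have := hG e he.1
    refine mem_image.2 ⟨e, mem_filter.2 ⟨he.1, ?_⟩, ?_⟩
    · simp only [Interleave]; omega
    · unfold innerEnd; split_ifs <;> omega
  · refine card_le_card fun y hy => ?_
    obtain ⟨e, he, rfl⟩ := mem_image.1 hy
    simp only [mem_filter, PassR] at he
    have := hG e he.1
    refine mem_image.2 ⟨e, mem_filter.2 ⟨he.1, ?_⟩, ?_⟩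
    · simp only [Interleave]; omega
    · unfold innerEnd; split_ifs <;> omega
  · refine card_le_one.2 ?_
    have : ∀ y ∈ (G.filter (EdgeX u w v)).image (innerEnd u v), y = w := by
      intro y hy
      obtain ⟨e, he, rfl⟩ := mem_image.1 hy
      simp only [mem_filter, EdgeX] at he
      have := hG e he.1
      unfold innerEnd; split_ifs <;> omega
    exact fun y hy z hz => (this y hy).trans (this z hz).symm

end MergeEnds

theorem card_edge_le_one (G : Finset (ℕ × ℕ)) (u v : ℕ) :
    (G.filter fun e => e.1 = u ∧ e.2 = v).card ≤ 1 := by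
  refine card_le_one.2 ?_
  rintro ⟨a, b⟩ ha ⟨c, d⟩ hb
  simp only [mem_filter] at ha hb
  simp [ha.2.1, ha.2.2, hb.2.1, hb.2.2]

/-- The bound on the number of edges within an arc whose chord is crossed at most four times, when
every edge is crossed at most four times. -/
theorem arc_bound (hG : ∀ e ∈ G, e.1 < e.2) (h4 : ∀ e ∈ G, (crossers G e.1 e.2).card ≤ 4)
    (n : ℕ) : ∀ u v, v = u + n + 1 → (crossers G u v).card ≤ 4 →
      20 * inside G u v + gain (crossers G u v).card (innerEnds G u v).card +
        4 * (crossers G u v).card ≤ 57 * n + 20 + 2 * insideCrossings G u v := by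
  induction n using Nat.strong_induction_on with
  | _ n ih =>
    intro u v hv hk
    rcases Nat.eq_zero_or_pos n with rfl | hn
    · obtain rfl : v = u + 1 := hv
      have h1 : inside G u (u + 1) ≤ 1 := by
        refine le_trans (card_le_card fun e he => ?_) (card_edge_le_one G u (u + 1))
        simp only [mem_filter] at he ⊢
        have := hG e he.1
        exact ⟨he.1, by omega⟩
      rw [card_crossers_succ hG]
      simp only [gain]
      omega
    · obtain ⟨w, huw, hwv, hL, hR⟩ := exists_apex hG h4 (show u + 1 < v by omega) hk
      have hl := ih (w - u - 1) (by omega) u w (by omega) hL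
      have hr := ih (v - w - 1) (by omega) w v (by omega) hR
      have hm := insideCrossings_merge hG huw hwv
      rw [card_filter_mergePair hG huw] at hm
      have hin := inside_merge hG huw hwv
      have hδ := card_edge_le_one G u v
      have eL := card_edgeL_le (G := G) huw hwv
      have eR := card_edgeR_le (G := G) (v := v) huw
      have eM := card_edgeM_le (G := G) (u := u) (w := w) (v := v)
      have rL := card_innerEnds_le G u w
      have rR := card_innerEnds_le G w v
      have rL0 := card_innerEnds_pos (G := G) (u := u) (v := w)
      have rR0 := card_innerEnds_pos (G := G) (u := w) (v := v)
      have hends := card_innerEnds_merge hG huw hwv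
      have hδk : 20 * (G.filter fun e => e.1 = u ∧ e.2 = v).card + 4 * (crossers G u v).card ≤
          20 + 4 * ((G.filter fun e => e.1 = u ∧ e.2 = v).card * (crossers G u v).card) := by
        generalize (G.filter fun e => e.1 = u ∧ e.2 = v).card = δ at hδ
        interval_cases δ <;> omega
      rw [card_crossers_left hG huw hwv] at hl hL rL rL0
      rw [card_crossers_right hG huw hwv] at hr hR rR rR0
      generalize (G.filter fun e => e.1 = u ∧ e.2 = v).card * (crossers G u v).card = t at *
      rw [card_crossers_merge hG huw hwv] at hk hδk ⊢
      have key := gainStep_of_le hL hR hk eL rL eR rR rL0 rR0 eM hends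
      have hn' : 57 * n = 57 * (w - u - 1) + 57 * (v - w - 1) + 57 := by omega
      linarith

/-- The edges `i < j` and `k < l` satisfy `i < k < j < l`. -/
def Follows (e f : ℕ × ℕ) : Prop := e.1 < f.1 ∧ f.1 < e.2 ∧ e.2 < f.2

/-- The number of unordered pairs of crossing edges of `G`. -/
noncomputable def crossingPairs (G : Finset (ℕ × ℕ)) : ℕ :=
  ((G ×ˢ G).filter fun x => Follows x.1 x.2).card

theorem card_filter_interleave (G : Finset (ℕ × ℕ)) :
    ((G ×ˢ G).filter fun x => Interleave x.1 x.2).card = 2 * crossingPairs G := by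
  rw [two_mul]
  nth_rewrite 2 [crossingPairs]
  rw [← card_filter_swap G fun x => Follows x.1 x.2]
  refine card_filter_eq_add (fun _ _ => Iff.rfl) fun x _ => ?_
  simp only [Follows, Prod.fst_swap, Prod.snd_swap]
  omega

theorem twenty_mul_card_le_of_le_four (hG : ∀ e ∈ G, e.1 < e.2) {n : ℕ} (hn : ∀ e ∈ G, e.2 < n)
    (h4 : ∀ e ∈ G, (crossers G e.1 e.2).card ≤ 4) :
    20 * G.card ≤ 4 * crossingPairs G + 57 * n := by
  rcases lt_or_ge n 2 with h2 | h2
  · have : G = ∅ := by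
      refine eq_empty_of_forall_notMem fun e he => ?_
      have := hG e he; have := hn e he
      omega
    simp [this]
  · obtain ⟨k, rfl⟩ := Nat.exists_eq_add_of_le' h2
    have h0 : (crossers G 0 (k + 1)).card = 0 := by
      rw [card_crossers, card_eq_zero, filter_eq_empty_iff]
      intro e he; have := hn e he; omega
    have h := arc_bound hG h4 k 0 (k + 1) (by omega) (by omega)
    have hin : inside G 0 (k + 1) = G.card := by
      rw [inside, filter_true_of_mem]
      intro e he; have := hn e he; omega
    have hcr : insideCrossings G 0 (k + 1) ≤ 2 * crossingPairs G := by
      rw [← card_filter_interleave]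
      refine card_le_card fun x => ?_
      simp only [mem_filter]
      exact fun hx => ⟨hx.1, hx.2.1⟩
    omega

theorem twenty_mul_card_le {n : ℕ} (G : Finset (ℕ × ℕ)) (hG : ∀ e ∈ G, e.1 < e.2)
    (hn : ∀ e ∈ G, e.2 < n) : 20 * G.card ≤ 4 * crossingPairs G + 57 * n := by
  induction hc : G.card generalizing G with
  | zero => omega
  | succ c ih =>
    rw [← hc]
    by_cases h4 : ∀ e ∈ G, (crossers G e.1 e.2).card ≤ 4
    · exact twenty_mul_card_le_of_le_four hG hn h4
    · push Not at h4
      obtain ⟨e, he, h5⟩ := h4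
      have h := ih (G.erase e) (fun f hf => hG f (mem_of_mem_erase hf))
        (fun f hf => hn f (mem_of_mem_erase hf)) (by rw [card_erase_of_mem he]; omega)
      have hs := card_filter_interleave G
      have hs' := card_filter_interleave (G.erase e)
      have h1 : ((G ×ˢ G).filter fun x => x.1 = e ∧ Interleave (e.1, e.2) x.2).card =
          (crossers G e.1 e.2).card := by
        rw [card_filter_prod G (fun x => x = e) (Interleave (e.1, e.2)), filter_eq' G e,
          if_pos he, card_singleton, one_mul, crossers]
      have h2 := card_filter_swap G fun x => x.1 = e ∧ Interleave (e.1, e.2) x.2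
      have h3 : ((G.erase e ×ˢ G.erase e).filter fun x => Interleave x.1 x.2).card ≤
          ((G ×ˢ G).filter fun x => x.1 ≠ e ∧ x.2 ≠ e ∧ Interleave x.1 x.2).card := by
        refine card_le_card fun x => ?_
        simp only [mem_filter, mem_product, mem_erase]
        tauto
      have h6 : ((G ×ˢ G).filter fun x => x.1 ≠ e ∧ x.2 ≠ e ∧ Interleave x.1 x.2).card +
          ((G ×ˢ G).filter fun x => x.1 = e ∧ Interleave (e.1, e.2) x.2).card +
          ((G ×ˢ G).filter fun x => x.swap.1 = e ∧ Interleave (e.1, e.2) x.swap.2).card ≤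
          ((G ×ˢ G).filter fun x => Interleave x.1 x.2).card := by
        refine card_filter_add_add_le ?_ ?_ ?_ ?_ ?_ ?_ <;> rintro ⟨a, b⟩ -
        · exact fun h => h.2.2
        · rintro ⟨rfl, h⟩; exact h
        · rintro ⟨rfl, h⟩; exact h.symm
        · exact fun h h' => h.1 h'.1
        · exact fun h h' => h.2.1 h'.1
        · rintro ⟨rfl, h⟩ ⟨h', -⟩
          obtain rfl : b = a := h'
          simp only [Interleave] at h
          omega
      omega

/-- The linear bound for the subgraph induced by a set of vertices. -/
theorem twenty_mul_card_induced_le (hG : ∀ e ∈ G, e.1 < e.2) (S : Finset ℕ) :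
    20 * (G.filter fun e => e.1 ∈ S ∧ e.2 ∈ S).card ≤
      4 * ((G ×ˢ G).filter fun x => Follows x.1 x.2 ∧
        (x.1.1 ∈ S ∧ x.1.2 ∈ S) ∧ x.2.1 ∈ S ∧ x.2.2 ∈ S).card + 57 * S.card := by
  set ρ : ℕ → ℕ := fun x => (S.filter (· < x)).card with hρ
  have mono : ∀ {x y}, x ∈ S → x < y → ρ x < ρ y := by
    intro x y hx hxy
    refine card_lt_card ⟨fun z => ?_, fun h => ?_⟩
    · simp only [mem_filter]; exact fun hz => ⟨hz.1, hz.2.trans hxy⟩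
    · have := h (mem_filter.2 ⟨hx, hxy⟩)
      simp at this
  have lt_iff : ∀ {x y}, x ∈ S → y ∈ S → (ρ x < ρ y ↔ x < y) := by
    refine fun {x y} hx hy => ⟨fun h => ?_, mono hx⟩
    by_contra! hle
    rcases hle.eq_or_lt with rfl | hlt
    · exact lt_irrefl _ h
    · exact lt_asymm h (mono hy hlt)
  have inj : ∀ {x y}, x ∈ S → y ∈ S → ρ x = ρ y → x = y := by
    intro x y hx hy h
    have h1 := lt_iff hx hy; have h2 := lt_iff hy hx
    omega
  have hlt : ∀ {x}, x ∈ S → ρ x < S.card := by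
    refine fun {x} hx => card_lt_card ⟨filter_subset _ _, fun h => ?_⟩
    have := h hx
    simp at this
  set H := (G.filter fun e => e.1 ∈ S ∧ e.2 ∈ S).image (Prod.map ρ ρ) with hH
  have hmem : ∀ e ∈ H, ∃ f ∈ G, (f.1 ∈ S ∧ f.2 ∈ S) ∧ e = (ρ f.1, ρ f.2) := by
    intro e he
    obtain ⟨f, hf, rfl⟩ := mem_image.1 he
    obtain ⟨h1, h2⟩ := mem_filter.1 hf
    exact ⟨f, h1, h2, rfl⟩
  have hcard : H.card = (G.filter fun e => e.1 ∈ S ∧ e.2 ∈ S).card := by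
    refine card_image_of_injOn ?_
    rintro ⟨a, b⟩ ha ⟨c, d⟩ hb h
    simp only [coe_filter, Set.mem_ofPred_eq] at ha hb
    simp only [Prod.map_apply, Prod.mk.injEq] at h
    rw [inj ha.2.1 hb.2.1 h.1, inj ha.2.2 hb.2.2 h.2]
  have hbound := twenty_mul_card_le (n := S.card) H
    (fun e he => by
      obtain ⟨f, hf, h, rfl⟩ := hmem e he
      exact mono h.1 (hG f hf))
    (fun e he => by
      obtain ⟨f, hf, h, rfl⟩ := hmem e he
      exact hlt h.2)
  have hcr : crossingPairs H ≤ ((G ×ˢ G).filter fun x => Follows x.1 x.2 ∧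
        (x.1.1 ∈ S ∧ x.1.2 ∈ S) ∧ x.2.1 ∈ S ∧ x.2.2 ∈ S).card := by
    refine le_trans (card_le_card ?_)
      (card_image_le (f := Prod.map (Prod.map ρ ρ) (Prod.map ρ ρ)))
    rintro ⟨e, f⟩ hx
    simp only [mem_filter, mem_product] at hx
    obtain ⟨e', he', he, rfl⟩ := hmem e hx.1.1
    obtain ⟨f', hf', hf, rfl⟩ := hmem f hx.1.2
    refine mem_image.2 ⟨(e', f'), ?_, rfl⟩
    simp only [mem_filter, mem_product]
    refine ⟨⟨he', hf'⟩, ?_, he, hf⟩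
    have h := hx.2
    simp only [Follows] at h ⊢
    exact ⟨(lt_iff he.1 hf.1).1 h.1, (lt_iff hf.1 he.2).1 h.2.1, (lt_iff he.2 hf.2).1 h.2.2⟩
  omega

section Sampling

variable {p : ℝ} {n : ℕ}

/-- The probability that a random subset of `range n`, containing each element independently with
probability `p`, contains a given set `T`. -/
theorem sum_powerset_superset (p : ℝ) {T U : Finset ℕ} (hT : T ⊆ U) :
    ∑ S ∈ U.powerset with T ⊆ S, p ^ S.card * (1 - p) ^ (U.card - S.card) = p ^ T.card := by
  have h1 : (U.powerset.filter fun S => T ⊆ S) = (U \ T).powerset.image (T ∪ ·) := by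
    rw [← Icc_eq_image_powerset hT]
    ext S
    simp [and_comm]
  rw [h1, sum_image]
  · have h2 : ∀ S ∈ (U \ T).powerset, p ^ (T ∪ S).card * (1 - p) ^ (U.card - (T ∪ S).card) =
        p ^ T.card * (p ^ S.card * (1 - p) ^ ((U \ T).card - S.card)) := by
      intro S hS
      rw [mem_powerset, subset_sdiff] at hS
      rw [card_union_of_disjoint hS.2.symm, card_sdiff_of_subset hT, pow_add, mul_assoc,
        Nat.sub_sub]
    rw [sum_congr rfl h2, ← mul_sum, sum_pow_mul_eq_add_pow]
    simp
  · intro A hA B hB h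
    simp only [coe_powerset, Set.mem_preimage, Set.mem_powerset_iff, coe_subset,
      subset_sdiff] at hA hB
    rw [← union_sdiff_cancel_left hA.2.symm, ← union_sdiff_cancel_left hB.2.symm]
    exact congrArg (· \ T) h

theorem sum_powerset_mul_card {α : Type*} (p : ℝ) (U : Finset ℕ) (A : Finset α)
    (T : α → Finset ℕ) {j : ℕ} (hT : ∀ a ∈ A, T a ⊆ U) (hj : ∀ a ∈ A, (T a).card = j) :
    ∑ S ∈ U.powerset, p ^ S.card * (1 - p) ^ (U.card - S.card) * (A.filter fun a => T a ⊆ S).card =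
      A.card * p ^ j := by
  have h1 : ∀ S : Finset ℕ, ((A.filter fun a => T a ⊆ S).card : ℝ) =
      ∑ a ∈ A, if T a ⊆ S then (1 : ℝ) else 0 := by
    intro S
    rw [card_filter]
    push_cast
    rfl
  simp only [h1, mul_sum]
  rw [sum_comm, ← nsmul_eq_mul, ← sum_const]
  refine sum_congr rfl fun a ha => ?_
  simp only [mul_ite, mul_one, mul_zero]
  rw [← sum_filter, sum_powerset_superset p (hT a ha), hj a ha]

theorem sampling_bound (hG : ∀ e ∈ G, e.1 < e.2) (hn : ∀ e ∈ G, e.2 < n) (hp0 : 0 ≤ p)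
    (hp1 : p ≤ 1) : 20 * (G.card * p ^ 2) ≤ 4 * (crossingPairs G * p ^ 4) + 57 * (n * p ^ 1) := by
  have h1 := sum_powerset_mul_card p (range n) G (fun e => {e.1, e.2}) (j := 2)
    (fun e he => by
      have := hG e he; have := hn e he
      intro x; simp only [mem_insert, mem_singleton, mem_range]; omega)
    (fun e he => card_pair (hG e he).ne)
  have h2 := sum_powerset_mul_card p (range n) ((G ×ˢ G).filter fun x => Follows x.1 x.2)
    (fun x => {x.1.1, x.1.2, x.2.1, x.2.2}) (j := 4)
    (fun x hx => by
      rw [mem_filter, mem_product] at hx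
      obtain ⟨⟨hx1, hx2⟩, h1, h2, h3⟩ := hx
      have := hn _ hx1; have := hn _ hx2
      intro y; simp only [mem_insert, mem_singleton, mem_range]; omega)
    (fun x hx => by
      obtain ⟨h1, h2, h3⟩ := (mem_filter.1 hx).2
      rw [card_insert_of_notMem, card_insert_of_notMem, card_pair] <;>
        simp <;> omega)
  have h3 := sum_powerset_mul_card p (range n) (range n) (fun v => {v}) (j := 1)
    (fun v hv => by simpa using hv) (fun v _ => card_singleton v)
  rw [card_range] at h1 h2 h3
  rw [crossingPairs, ← h1, ← h2, ← h3, mul_sum, mul_sum, mul_sum, ← sum_add_distrib]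
  refine sum_le_sum fun S hS => ?_
  have hS' : ((range n).filter fun v => {v} ⊆ S) = S := by
    ext v
    simp only [mem_filter, singleton_subset_iff]
    exact ⟨fun h => h.2, fun h => ⟨mem_powerset.1 hS h, h⟩⟩
  have h := twenty_mul_card_induced_le hG S
  have e1 : (G.filter fun e => {e.1, e.2} ⊆ S) = G.filter fun e => e.1 ∈ S ∧ e.2 ∈ S := by
    simp only [insert_subset_iff, singleton_subset_iff]
  have e2 : (((G ×ˢ G).filter fun x => Follows x.1 x.2).filter fun x =>
      {x.1.1, x.1.2, x.2.1, x.2.2} ⊆ S) = (G ×ˢ G).filter fun x => Follows x.1 x.2 ∧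
        (x.1.1 ∈ S ∧ x.1.2 ∈ S) ∧ x.2.1 ∈ S ∧ x.2.2 ∈ S := by
    rw [filter_filter]
    simp only [insert_subset_iff, singleton_subset_iff, and_assoc]
  rw [hS', e1, e2]
  have h' : (20 : ℝ) * (G.filter fun e => e.1 ∈ S ∧ e.2 ∈ S).card ≤
      4 * ((G ×ˢ G).filter fun x => Follows x.1 x.2 ∧
        (x.1.1 ∈ S ∧ x.1.2 ∈ S) ∧ x.2.1 ∈ S ∧ x.2.2 ∈ S).card + 57 * S.card := by
    exact_mod_cast h
  have hw : 0 ≤ p ^ S.card * (1 - p) ^ (n - S.card) :=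
    mul_nonneg (pow_nonneg hp0 _) (pow_nonneg (by linarith) _)
  nlinarith [mul_le_mul_of_nonneg_left h' hw]

/-- The crossing lemma for edges between positions on a convex curve. -/
theorem crossing_lemma_positions (hG : ∀ e ∈ G, e.1 < e.2) (hn : ∀ e ∈ G, e.2 < n)
    (h : (171 / 40 : ℝ) * n ≤ G.card) :
    (8000 / 87723 : ℝ) * (G.card : ℝ) ^ 3 / (n : ℝ) ^ 2 ≤ crossingPairs G := by
  rcases Nat.eq_zero_or_pos n with rfl | hn0
  · simp
  have hn1 : (0 : ℝ) < n := by exact_mod_cast hn0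
  have hm : (0 : ℝ) < G.card := by linarith [mul_pos (show (0 : ℝ) < 171 / 40 by norm_num) hn1]
  have hs := sampling_bound (p := 171 / 40 * n / G.card) hG hn (by positivity)
    (by rw [div_le_one hm]; exact h)
  rw [div_le_iff₀ (by positivity)]
  field_simp at hs
  nlinarith [hs]

end Sampling

section Geometry

/-- Twice the signed area of the triangle `a b c`. -/
noncomputable def orient (a b c : Pt) : ℝ :=
  (b 0 - a 0) * (c 1 - a 1) - (b 1 - a 1) * (c 0 - a 0)

variable {V : Finset Pt}

theorem pt_ext {a b : Pt} (h0 : a 0 = b 0) (h1 : a 1 = b 1) : a = b := by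
  ext i
  fin_cases i
  · exact h0
  · exact h1

theorem ne_convex_combination (hV : ConvexPos V) {p a b c : Pt} (hp : p ∈ V) (ha : a ∈ V)
    (hb : b ∈ V) (hc : c ∈ V) (hap : a ≠ p) (hbp : b ≠ p) (hcp : c ≠ p) {α β γ : ℝ} (hα : 0 ≤ α)
    (hβ : 0 ≤ β) (hγ : 0 ≤ γ) (h : α + β + γ = 1) : p ≠ α • a + β • b + γ • c := by
  intro h'
  refine hV p hp ?_
  have hsub := subset_convexHull ℝ ((V.erase p : Finset Pt) : Set Pt)
  have hmem : ∀ {q}, q ∈ V → q ≠ p → q ∈ convexHull ℝ ((V.erase p : Finset Pt) : Set Pt) :=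
    fun hq hqp => hsub (mem_coe.2 (mem_erase.2 ⟨hqp, hq⟩))
  have := (convex_convexHull ℝ ((V.erase p : Finset Pt) : Set Pt)).sum_mem (t := univ)
    (w := ![α, β, γ]) (z := ![a, b, c])
    (by intro i _; fin_cases i <;> simpa)
    (by simpa [Fin.sum_univ_three] using h)
    (by
      intro i _
      fin_cases i
      · exact hmem ha hap
      · exact hmem hb hbp
      · exact hmem hc hcp)
  rw [Fin.sum_univ_three] at this
  rw [h']
  simpa [← h'] using this

theorem ne_lineMap (hV : ConvexPos V) {a b c : Pt} (ha : a ∈ V) (hb : b ∈ V) (hc : c ∈ V)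
    (hab : a ≠ b) (hac : a ≠ c) (hbc : b ≠ c) (t : ℝ) : c ≠ (1 - t) • a + t • b := by
  intro h
  have h0 : c 0 = (1 - t) * a 0 + t * b 0 := by simp [h]
  have h1 : c 1 = (1 - t) * a 1 + t * b 1 := by simp [h]
  rcases lt_or_ge t 0 with ht | ht
  · have hd : 0 < 1 - t := by linarith
    refine ne_convex_combination hV ha hc hb hb hac.symm hab.symm hab.symm (α := 1 / (1 - t))
      (β := -t / (1 - t)) (γ := 0) (by positivity) (div_nonneg (by linarith) hd.le) le_rfl
      (by field_simp; ring) (pt_ext ?_ ?_)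
    · simp [h0]; field_simp; ring
    · simp [h1]; field_simp; ring
  rcases le_or_gt t 1 with ht1 | ht1
  · refine ne_convex_combination hV hc ha hb hb hac hbc hbc (α := 1 - t) (β := t) (γ := 0)
      (by linarith) ht le_rfl (by ring) (by simpa using h)
  · have hd : 0 < t := by linarith
    refine ne_convex_combination hV hb hc ha ha hbc.symm hab hab (α := 1 / t)
      (β := (t - 1) / t) (γ := 0) (by positivity) (div_nonneg (by linarith) hd.le) le_rfl
      (by field_simp; ring) (pt_ext ?_ ?_)
    · simp [h0]; field_simp; ring
    · simp [h1]; field_simp; ring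

theorem orient_ne_zero (hV : ConvexPos V) {a b c : Pt} (ha : a ∈ V) (hb : b ∈ V) (hc : c ∈ V)
    (hab : a ≠ b) (hac : a ≠ c) (hbc : b ≠ c) : orient a b c ≠ 0 := by
  intro h
  unfold orient at h
  by_cases h0 : b 0 = a 0
  · have h1 : b 1 - a 1 ≠ 0 := fun h1 => hab (pt_ext h0.symm (by linarith))
    have h2 : c 0 = a 0 := by
      rw [h0, sub_self, zero_mul, zero_sub, neg_eq_zero] at h
      linarith [(mul_eq_zero.1 h).resolve_left h1]
    refine ne_lineMap hV ha hb hc hab hac hbc ((c 1 - a 1) / (b 1 - a 1)) (pt_ext ?_ ?_)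
    · simp [h0, h2]; ring
    · simp; field_simp; ring
  · have h1 : b 0 - a 0 ≠ 0 := sub_ne_zero.2 h0
    refine ne_lineMap hV ha hb hc hab hac hbc ((c 0 - a 0) / (b 0 - a 0)) (pt_ext ?_ ?_)
    · simp; field_simp; ring
    · simp; field_simp; linarith

theorem orient_triangle (hV : ConvexPos V) {a b c p : Pt} (hp : p ∈ V) (ha : a ∈ V) (hb : b ∈ V)
    (hc : c ∈ V) (hap : a ≠ p) (hbp : b ≠ p) (hcp : c ≠ p) (h1 : 0 < orient a b p)
    (h2 : 0 < orient b c p) (h3 : 0 < orient c a p) : False := by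
  have hD : 0 < orient b c p + orient c a p + orient a b p := by positivity
  refine ne_convex_combination hV hp ha hb hc hap hbp hcp
    (α := orient b c p / (orient b c p + orient c a p + orient a b p))
    (β := orient c a p / (orient b c p + orient c a p + orient a b p))
    (γ := orient a b p / (orient b c p + orient c a p + orient a b p))
    (by positivity) (by positivity) (by positivity) (by field_simp) (pt_ext ?_ ?_)
  · simp
    field_simp
    unfold orient
    ring
  · simp
    field_simp
    unfold orient
    ring

theorem openSegment_inter_nonempty {a b c d : Pt} (h1 : 0 < orient a c b) (h2 : 0 < orient c b d)
    (h3 : 0 < orient a c d) (h4 : 0 < orient a b d) :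
    (openSegment ℝ a b ∩ openSegment ℝ c d).Nonempty := by
  have hs : orient a b d + orient a c b = orient c b d + orient a c d := by
    unfold orient; ring
  have hD : 0 < orient c b d + orient a c d := by positivity
  refine ⟨(orient c b d / (orient c b d + orient a c d)) • a +
    (orient a c d / (orient c b d + orient a c d)) • b, ⟨_, _, by positivity, by positivity, ?_, rfl⟩,
    orient a b d / (orient c b d + orient a c d), orient a c b / (orient c b d + orient a c d),
    by positivity, by positivity, ?_, pt_ext ?_ ?_⟩
  · field_simp
  · rw [← add_div, hs, div_self hD.ne']
  · simp
    field_simp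
    unfold orient
    ring
  · simp
    field_simp
    unfold orient
    ring

/-- Points in convex position can be numbered in counterclockwise order. -/
theorem exists_position (hV : ConvexPos V) : ∃ f : Pt → ℕ, Set.InjOn f V ∧
    (∀ a ∈ V, f a < V.card) ∧
    ∀ a ∈ V, ∀ b ∈ V, ∀ c ∈ V, f a < f b → f b < f c → 0 < orient a b c := by
  rcases V.eq_empty_or_nonempty with rfl | hne
  · exact ⟨fun _ => 0, by simp, by simp, by simp⟩
  obtain ⟨o, ho, hmin⟩ := V.exists_min_image (fun p => toLex (p 0, p 1)) hne
  have hx : ∀ a ∈ V, o 0 ≤ a 0 := by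
    intro a ha
    have := hmin a ha
    rw [Prod.Lex.toLex_le_toLex] at this
    rcases this with h | h
    · exact h.le
    · exact h.1.le
  have hy : ∀ a ∈ V, a 0 = o 0 → o 1 ≤ a 1 := by
    intro a ha h0
    have := hmin a ha
    rw [Prod.Lex.toLex_le_toLex] at this
    rcases this with h | h
    · exact absurd h0 h.ne'
    · exact h.2
  have hne0 : ∀ {a b}, a ∈ V → b ∈ V → a ≠ o → b ≠ o → a ≠ b → orient o a b ≠ 0 :=
    fun ha hb hao hbo hab => orient_ne_zero hV ho ha hb hao.symm hbo.symm hab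
  have hswap : ∀ a b, orient o b a = - orient o a b := by
    intro a b; unfold orient; ring
  have hself : ∀ a, orient o a a = 0 := by
    intro a; unfold orient; ring
  have ho' : ∀ a, orient o o a = 0 := by
    intro a; unfold orient; ring
  have trans : ∀ {a b c}, a ∈ V → b ∈ V → c ∈ V → 0 < orient o a b → 0 < orient o b c →
      0 < orient o a c := by
    intro a b c ha hb hc h1 h2
    have hao : a ≠ o := by rintro rfl; rw [ho'] at h1; exact lt_irrefl _ h1
    have hbo : b ≠ o := by rintro rfl; rw [ho'] at h2; exact lt_irrefl _ h2
    have hco : c ≠ o := by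
      rintro rfl
      rw [hswap, ho'] at h2
      simp at h2
    have hac : a ≠ c := by
      rintro rfl
      rw [hswap] at h2
      linarith
    have h3 := hne0 ha hc hao hco hac
    have hid : (b 0 - o 0) * orient o a c =
        (a 0 - o 0) * orient o b c + (c 0 - o 0) * orient o a b := by
      unfold orient; ring
    have ha0 := hx a ha; have hb0 := hx b hb; have hc0 := hx c hc
    rcases hb0.eq_or_lt with hb0 | hb0
    · have hb1 := hy b hb hb0.symm
      unfold orient at h2
      rw [← hb0] at h2
      nlinarith [mul_nonneg (sub_nonneg.2 hb1) (sub_nonneg.2 hc0)]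
    · have h4 : 0 ≤ (b 0 - o 0) * orient o a c := by
        rw [hid]
        exact add_nonneg (mul_nonneg (sub_nonneg.2 ha0) h2.le)
          (mul_nonneg (sub_nonneg.2 hc0) h1.le)
      exact lt_of_le_of_ne (nonneg_of_mul_nonneg_right h4 (sub_pos.2 hb0)) h3.symm
  set g : Pt → ℕ := fun a => (V.filter fun r => r ≠ a ∧ (r = o ∨ 0 < orient o r a)).card with hg
  have hlt : ∀ a ∈ V, ∀ b ∈ V, a ≠ b → (a = o ∨ 0 < orient o a b) → g a < g b := by
    intro a ha b hb hab h
    refine card_lt_card ⟨fun r => ?_, fun hsub => ?_⟩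
    · simp only [mem_filter]
      rintro ⟨hr, hra, hr'⟩
      rcases h with rfl | h
      · rcases hr' with rfl | hr'
        · exact absurd rfl hra
        · rw [hswap, ho'] at hr'
          simp at hr'
      · rcases hr' with rfl | hr'
        · refine ⟨hr, ?_, Or.inl rfl⟩
          rintro rfl
          rw [hswap, ho'] at h
          simp at h
        · have := trans hr ha hb hr' h
          refine ⟨hr, ?_, Or.inr this⟩
          rintro rfl
          rw [hself] at this
          exact lt_irrefl _ this
    · have := (mem_filter.1 (hsub (mem_filter.2 ⟨ha, hab, h⟩))).2.1
      exact this rfl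
  have htot : ∀ a ∈ V, ∀ b ∈ V, a ≠ b →
      (a = o ∨ 0 < orient o a b) ∨ (b = o ∨ 0 < orient o b a) := by
    intro a ha b hb hab
    by_cases hao : a = o
    · exact Or.inl (Or.inl hao)
    by_cases hbo : b = o
    · exact Or.inr (Or.inl hbo)
    rcases (hne0 ha hb hao hbo hab).lt_or_gt with h | h
    · right; right; rw [hswap]; linarith
    · exact Or.inl (Or.inr h)
  have hrel : ∀ a ∈ V, ∀ b ∈ V, g a < g b → a ≠ b ∧ (a = o ∨ 0 < orient o a b) := by
    intro a ha b hb h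
    have hab : a ≠ b := by rintro rfl; exact lt_irrefl _ h
    refine ⟨hab, (htot a ha b hb hab).resolve_right fun h' => ?_⟩
    exact lt_asymm h (hlt b hb a ha hab.symm h')
  have hpos : ∀ a ∈ V, ∀ b ∈ V, g a < g b → b ≠ o := by
    rintro a ha b hb h rfl
    have hab := (hrel a ha b hb h).1
    exact lt_asymm h (hlt b hb a ha hab.symm (Or.inl rfl))
  refine ⟨g, ?_, ?_, ?_⟩
  · intro a ha b hb h
    by_contra hab
    rcases htot a ha b hb hab with h' | h'
    · exact (hlt a ha b hb hab h').ne h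
    · exact (hlt b hb a ha (Ne.symm hab) h').ne' h
  · intro a ha
    refine card_lt_card ⟨filter_subset _ _, fun h => ?_⟩
    exact (mem_filter.1 (h ha)).2.1 rfl
  · intro a ha b hb c hc hab hbc
    obtain ⟨nab, hab'⟩ := hrel a ha b hb hab
    obtain ⟨nbc, hbc'⟩ := hrel b hb c hc hbc
    obtain ⟨nac, hac'⟩ := hrel a ha c hc (hab.trans hbc)
    have hbo := hpos a ha b hb hab
    have hco := hpos b hb c hc hbc
    have hbc' := hbc'.resolve_left hbo
    rcases eq_or_ne a o with rfl | hao
    · exact hbc'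
    have hab' := hab'.resolve_left hao
    rcases (orient_ne_zero hV ha hb hc nab nac nbc).lt_or_gt with h | h
    · refine (orient_triangle hV hb ho ha hc hbo.symm nab nbc.symm hab' ?_ ?_).elim
      · have : orient a c b = - orient a b c := by unfold orient; ring
        rw [this]; linarith
      · have : orient c o b = orient o b c := by unfold orient; ring
        rw [this]; exact hbc'
    · exact h

end Geometry

section Drawing

variable {V : Finset Pt} {E : Finset (Sym2 Pt)} {f : Pt → ℕ}

/-- The positions of the endpoints of an edge, in increasing order. -/
noncomputable def positions (f : Pt → ℕ) (e : Sym2 Pt) : ℕ × ℕ := ((e.map f).inf, (e.map f).sup)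

theorem exists_positions (hf : Set.InjOn f V) (hnd : ∀ e ∈ E, ¬ e.IsDiag)
    (hmem : ∀ e ∈ E, ∀ p ∈ e, p ∈ V) {e : Sym2 Pt} (he : e ∈ E) :
    ∃ a ∈ V, ∃ b ∈ V, e = s(a, b) ∧ f a < f b ∧ positions f e = (f a, f b) := by
  induction e with
  | _ a b =>
    have ha := hmem _ he a (by simp)
    have hb := hmem _ he b (by simp)
    have hab : a ≠ b := by simpa using hnd _ he
    rcases lt_or_gt_of_ne fun h => hab (hf ha hb h) with h | h
    · exact ⟨a, ha, b, hb, rfl, h, by simp [positions, h.le]⟩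
    · exact ⟨b, hb, a, ha, Sym2.eq_swap, h, by simp [positions, h.le]⟩

theorem crossingPairs_image_positions_le (hf : Set.InjOn f V)
    (hor : ∀ a ∈ V, ∀ b ∈ V, ∀ c ∈ V, f a < f b → f b < f c → 0 < orient a b c)
    (hnd : ∀ e ∈ E, ¬ e.IsDiag) (hmem : ∀ e ∈ E, ∀ p ∈ e, p ∈ V) :
    crossingPairs (E.image (positions f)) ≤ crossingNumber E := by
  have h1 : crossingPairs (E.image (positions f)) ≤
      ((E ×ˢ E).filter fun x => Follows (positions f x.1) (positions f x.2)).card := by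
    refine le_trans (card_le_card ?_)
      (card_image_le (f := Prod.map (positions f) (positions f)))
    rintro ⟨x, y⟩ hxy
    obtain ⟨h, hfol⟩ := mem_filter.1 hxy
    obtain ⟨hx, hy⟩ := mem_product.1 h
    obtain ⟨d, hd, rfl⟩ := mem_image.1 hx
    obtain ⟨e, he, rfl⟩ := mem_image.1 hy
    exact mem_image.2 ⟨(d, e), mem_filter.2 ⟨mem_product.2 ⟨hd, he⟩, hfol⟩, rfl⟩
  refine h1.trans (card_le_card_of_injOn (fun x => s(x.1, x.2)) ?_ ?_)
  · rintro ⟨d, e⟩ hx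
    obtain ⟨h, hfol⟩ := mem_filter.1 (mem_coe.1 hx)
    obtain ⟨hd, he⟩ := mem_product.1 h
    refine mem_coe.2 (mem_filter.2 ⟨mk_mem_sym2_iff.2 ⟨hd, he⟩, ?_⟩)
    obtain ⟨a, ha, b, hb, rfl, -, hpd⟩ := exists_positions hf hnd hmem hd
    obtain ⟨a', ha', b', hb', rfl, -, hpe⟩ := exists_positions hf hnd hmem he
    simp only at hfol hpd hpe
    rw [hpd, hpe] at hfol
    obtain ⟨h1, h2, h3⟩ := hfol
    simp only at h1 h2 h3
    refine ⟨fun heq => ?_, openSegment_inter_nonempty (hor a ha a' ha' b hb h1 h2)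
      (hor a' ha' b hb b' hb' h2 h3) (hor a ha a' ha' b' hb' h1 (h2.trans h3))
      (hor a ha b hb b' hb' (h1.trans h2) h3)⟩
    have h4 := congrArg (positions f) heq
    simp only at h4
    rw [hpd, hpe] at h4
    exact h1.ne (Prod.ext_iff.1 h4).1
  · rintro ⟨d, e⟩ hx ⟨d', e'⟩ hy h
    have hx := (mem_filter.1 (mem_coe.1 hx)).2
    have hy := (mem_filter.1 (mem_coe.1 hy)).2
    rcases Sym2.eq_iff.1 h with ⟨h1, h2⟩ | ⟨h1, h2⟩
    · exact Prod.ext h1 h2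
    · simp only at h1 h2 hx hy
      subst h1 h2
      exact absurd hx.1 hy.1.not_gt

theorem injOn_positions (hf : Set.InjOn f V) (hnd : ∀ e ∈ E, ¬ e.IsDiag)
    (hmem : ∀ e ∈ E, ∀ p ∈ e, p ∈ V) : Set.InjOn (positions f) E := by
  intro d hd e he h
  obtain ⟨a, ha, b, hb, rfl, -, hpd⟩ := exists_positions hf hnd hmem (mem_coe.1 hd)
  obtain ⟨a', ha', b', hb', rfl, -, hpe⟩ := exists_positions hf hnd hmem (mem_coe.1 he)
  rw [hpd, hpe, Prod.mk.injEq] at h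
  rw [hf ha ha' h.1, hf hb hb' h.2]

end Drawing

end ConvexCrossing

/-- convex crossing lemma. -/
theorem stmt3 (V : Finset Pt) (E : Finset (Sym2 Pt)) (hV : ConvexPos V)
    (hnd : ∀ e ∈ E, ¬ e.IsDiag) (hmem : ∀ e ∈ E, ∀ p ∈ e, p ∈ V)
    (h : (171 / 40 : ℝ) * V.card ≤ E.card) :
    (8000 / 87723 : ℝ) * (E.card : ℝ) ^ 3 / (V.card : ℝ) ^ 2 ≤ (crossingNumber E : ℝ) := by
  obtain ⟨f, hf, hlt, hor⟩ := ConvexCrossing.exists_position hV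
  have hcard : (E.image (ConvexCrossing.positions f)).card = E.card :=
    Finset.card_image_of_injOn (ConvexCrossing.injOn_positions hf hnd hmem)
  have hpos : ∀ x ∈ E.image (ConvexCrossing.positions f), x.1 < x.2 ∧ x.2 < V.card := by
    intro x hx
    obtain ⟨e, he, rfl⟩ := Finset.mem_image.1 hx
    obtain ⟨a, -, b, hb, -, hab, hp⟩ := ConvexCrossing.exists_positions hf hnd hmem he
    rw [hp]
    exact ⟨hab, hlt b hb⟩
  rw [← hcard] at h ⊢
  refine (ConvexCrossing.crossing_lemma_positions (fun x hx => (hpos x hx).1)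
    (fun x hx => (hpos x hx).2) h).trans ?_
  exact_mod_cast ConvexCrossing.crossingPairs_image_positions_le hf hor hnd hmem
end

section
/- Every outer k-planar graph with a nonempty vertex set has a vertex of degree at most 2·√(k+1) + 2. -/
open scoped Classical

open Finset

/-- Twice the signed area of the triangle `a b c`. -/
noncomputable def signedArea (a b c : Pt) : ℝ :=
  (b 0 - a 0) * (c 1 - a 1) - (b 1 - a 1) * (c 0 - a 0)

theorem ConvexPos.not_combination {V : Finset Pt} (hV : ConvexPos V) {x a b c : Pt}
    (hx : x ∈ V) (ha : a ∈ V.erase x) (hb : b ∈ V.erase x) (hc : c ∈ V.erase x)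
    {α β γ : ℝ} (hα : 0 ≤ α) (hβ : 0 ≤ β) (hγ : 0 ≤ γ) (hs : 0 < α + β + γ) :
    (α + β + γ) • x ≠ α • a + β • b + γ • c := by
  intro h
  apply hV x hx
  have hconv := convex_convexHull ℝ ((V.erase x : Finset Pt) : Set Pt)
  have hmem := hconv.sum_mem (t := Finset.univ) (w := ![α / (α + β + γ), β / (α + β + γ),
    γ / (α + β + γ)]) (z := ![a, b, c])
    (by intro i _; fin_cases i <;> simp <;> positivity)
    (by simp [Fin.sum_univ_three]; field_simp)
    (by intro i _; fin_cases i <;> exact subset_convexHull ℝ _ (by assumption))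
  convert hmem using 1
  have h' : x = (α + β + γ)⁻¹ • (α • a + β • b + γ • c) := by
    rw [← h, smul_smul, inv_mul_cancel₀ hs.ne', one_smul]
  simp only [Fin.sum_univ_three, Matrix.cons_val_zero, Matrix.cons_val_one, Matrix.cons_val]
  rw [h', smul_add, smul_add, smul_smul, smul_smul, smul_smul]
  simp only [div_eq_inv_mul]

theorem openSegment_inter_nonempty_of_signedArea_pos {a b c d : Pt}
    (habc : 0 < signedArea a b c) (habd : 0 < signedArea a b d)
    (hacd : 0 < signedArea a c d) (hbcd : 0 < signedArea b c d) :
    (openSegment ℝ a c ∩ openSegment ℝ b d).Nonempty := by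
  have hsum : signedArea b c d + signedArea a b d = signedArea a c d + signedArea a b c := by
    simp only [signedArea]; ring
  have hS : 0 < signedArea a c d + signedArea a b c := by positivity
  set S := signedArea a c d + signedArea a b c with hSdef
  refine ⟨(signedArea b c d / S) • a + (signedArea a b d / S) • c,
    ⟨_, _, by positivity, by positivity, by rw [← add_div, hsum, div_self hS.ne'], rfl⟩,
    ⟨signedArea a c d / S, signedArea a b c / S, by positivity, by positivity,
      by rw [← add_div, ← hSdef, div_self hS.ne'], ?_⟩⟩
  ext i
  simp only [PiLp.add_apply, PiLp.smul_apply, smul_eq_mul]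
  field_simp
  fin_cases i <;> simp [signedArea] <;> ring

theorem ConvexPos.signedArea_pos {V : Finset Pt} (hV : ConvexPos V) {o a b c : Pt}
    (ho : o ∈ V) (ha : a ∈ V) (hb : b ∈ V) (hc : c ∈ V)
    (hoab : 0 < signedArea o a b) (hobc : 0 < signedArea o b c) :
    0 < signedArea a b c := by
  by_contra! h
  have hob : o ≠ b := by rintro rfl; simp [signedArea] at hobc
  have hab : a ≠ b := by rintro rfl; simp [signedArea] at hoab; linarith
  have hcb : c ≠ b := by rintro rfl; simp [signedArea] at hobc; linarith
  refine hV.not_combination hb (mem_erase.2 ⟨hob, ho⟩) (mem_erase.2 ⟨hab, ha⟩)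
    (mem_erase.2 ⟨hcb, hc⟩) (neg_nonneg.2 h) hobc.le hoab.le (by linarith) ?_
  ext i
  simp only [PiLp.add_apply, PiLp.smul_apply, smul_eq_mul]
  fin_cases i <;> simp [signedArea] <;> ring

/-- A point set in convex position can be listed counterclockwise, as witnessed by a real key. -/
theorem ConvexPos.exists_key_s5 {V : Finset Pt} (hV : ConvexPos V) (hne : V.Nonempty) :
    ∃ κ : Pt → ℝ, Set.InjOn κ V ∧ ∀ a ∈ V, ∀ b ∈ V, ∀ c ∈ V, κ a < κ b → κ b < κ c →
      0 < signedArea a b c := by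
  obtain ⟨o, ho, hmax⟩ := V.exists_max_image (fun v => v 0 ^ 2 + v 1 ^ 2) hne
  set f : Pt → ℝ := fun v => -(o 0 * (v 0 - o 0) + o 1 * (v 1 - o 1)) with hf
  set g : Pt → ℝ := fun v => o 1 * (v 0 - o 0) - o 0 * (v 1 - o 1) with hg
  have hfpos : ∀ v ∈ V, v ≠ o → 0 < f v := by
    intro v hv hvo
    have h1 := hmax v hv
    have h2 : 0 < (v 0 - o 0) ^ 2 + (v 1 - o 1) ^ 2 := by
      by_contra! h
      apply hvo
      ext i
      fin_cases i <;> simp <;> nlinarith [sq_nonneg (v 0 - o 0), sq_nonneg (v 1 - o 1)]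
    simp only [hf]
    nlinarith
  have hN : ∀ v ∈ V, v ≠ o → 0 < o 0 ^ 2 + o 1 ^ 2 := by
    intro v hv hvo
    by_contra! h
    have h0 : o 0 = 0 := by nlinarith [sq_nonneg (o 0), sq_nonneg (o 1)]
    have h1 : o 1 = 0 := by nlinarith [sq_nonneg (o 0), sq_nonneg (o 1)]
    have := hfpos v hv hvo
    simp [hf, h0, h1] at this
  have hfg : ∀ a b, f a * g b - g a * f b = (o 0 ^ 2 + o 1 ^ 2) * signedArea o a b := by
    intro a b
    simp only [hf, hg, signedArea]; ring
  have harea : ∀ a ∈ V, a ≠ o → ∀ b ∈ V, b ≠ o → g a / f a < g b / f b →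
      0 < signedArea o a b := by
    intro a ha hao b hb hbo h
    rw [div_lt_div_iff₀ (hfpos a ha hao) (hfpos b hb hbo)] at h
    have := hfg a b
    exact pos_of_mul_pos_right (by linarith : 0 < (o 0 ^ 2 + o 1 ^ 2) * signedArea o a b)
      (hN a ha hao).le
  have hcomb : ∀ a ∈ V, a ≠ o → ∀ b ∈ V, b ≠ o → g a / f a = g b / f b → f b ≤ f a → a = b := by
    intro a ha hao b hb hbo h hle
    by_contra hab
    have hfa := hfpos a ha hao
    have hfb := hfpos b hb hbo
    rw [div_eq_div_iff hfa.ne' hfb.ne'] at h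
    have hN' := hN a ha hao
    refine hV.not_combination hb (mem_erase.2 ⟨Ne.symm hbo, ho⟩) (mem_erase.2 ⟨hab, ha⟩)
      (mem_erase.2 ⟨hab, ha⟩) (sub_nonneg.2 hle) hfb.le le_rfl (by linarith) ?_
    have hx : f a * (b 0 - o 0) = f b * (a 0 - o 0) := by
      apply mul_left_cancel₀ hN'.ne'
      simp only [hf, hg] at h ⊢
      linear_combination (-o 1) * h
    have hy : f a * (b 1 - o 1) = f b * (a 1 - o 1) := by
      apply mul_left_cancel₀ hN'.ne'
      simp only [hf, hg] at h ⊢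
      linear_combination (o 0) * h
    ext i
    simp only [PiLp.add_apply, PiLp.smul_apply, smul_eq_mul]
    fin_cases i
    · simp only [Fin.zero_eta]; linear_combination hx
    · simp only [Fin.mk_one]; linear_combination hy
  refine ⟨fun v => if v = o then -1 else Real.exp (g v / f v), ?_, ?_⟩
  · intro a ha b hb hab
    have e1 := Real.exp_pos (g a / f a)
    have e2 := Real.exp_pos (g b / f b)
    by_cases hao : a = o <;> by_cases hbo : b = o <;> simp only [hao, hbo, if_true, if_false] at hab
    · rw [hao, hbo]
    · linarith
    · linarith
    · have h := Real.exp_injective hab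
      rcases le_total (f b) (f a) with hle | hle
      · exact hcomb a ha hao b hb hbo h hle
      · exact (hcomb b hb hbo a ha hao h.symm hle).symm
  · intro a ha b hb c hc hab hbc
    have e1 := Real.exp_pos (g a / f a)
    have e2 := Real.exp_pos (g b / f b)
    have hbo : b ≠ o := by
      intro h
      by_cases hao : a = o <;> simp only [h, hao, if_true, if_false] at hab <;> linarith
    have hco : c ≠ o := by
      intro h
      simp only [h, hbo, if_true, if_false] at hbc; linarith
    simp only [hbo, hco, if_false, Real.exp_lt_exp] at hbc
    have hobc := harea b hb hbo c hc hco hbc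
    by_cases hao : a = o
    · rwa [hao]
    simp only [hao, hbo, if_false, Real.exp_lt_exp] at hab
    exact hV.signedArea_pos ho ha hb hc (harea a ha hao b hb hbo hab) hobc

theorem exists_enumeration_of_injOn (V : Finset Pt) (κ : Pt → ℝ) (hκ : Set.InjOn κ V) :
    ∃ p : ℕ → Pt, Set.BijOn p (range #V) V ∧ ∀ i j, i < j → j < #V → κ (p i) < κ (p j) := by
  have hcard : #(V.image κ) = #V := card_image_of_injOn hκ
  set e := (V.image κ).orderEmbOfFin hcard
  have he : ∀ i, ∃ v ∈ V, κ v = e i := fun i =>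
    mem_image.1 ((V.image κ).orderEmbOfFin_mem hcard i)
  choose q hqV hq using he
  have hmono : ∀ i j : Fin #V, i < j → κ (q i) < κ (q j) := fun i j h => by
    rw [hq, hq]; exact e.strictMono h
  by_cases hV : V = ∅
  · subst hV
    exact ⟨fun _ => 0, by simp, by simp⟩
  have hpos : 0 < #V := card_pos.2 (nonempty_iff_ne_empty.2 hV)
  refine ⟨fun i => if h : i < #V then q ⟨i, h⟩ else 0, ⟨?_, ?_, ?_⟩, ?_⟩
  · intro i hi
    have hi' : i < #V := by simpa using hi
    simpa [hi'] using hqV ⟨i, hi'⟩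
  · intro i hi j hj hij
    have hi' : i < #V := by simpa using hi
    have hj' : j < #V := by simpa using hj
    simp only [hi', hj', dif_pos] at hij
    have h : e ⟨i, hi'⟩ = e ⟨j, hj'⟩ := by rw [← hq, ← hq, hij]
    simpa using e.injective h
  · intro v hv
    have : κ v ∈ Set.range e := by
      rw [range_orderEmbOfFin]; exact mem_coe.2 (mem_image_of_mem κ hv)
    obtain ⟨i, hi⟩ := this
    refine ⟨i, by simp, ?_⟩
    simp only [i.2, dif_pos]
    exact hκ (hqV i) hv ((hq i).trans hi)
  · intro i j hij hj
    simpa [hj, hij.trans hj] using hmono ⟨i, hij.trans hj⟩ ⟨j, hj⟩ hij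

/-- A point set in convex position can be listed so that interleaving chords cross. -/
theorem ConvexPos.exists_enumeration {V : Finset Pt} (hV : ConvexPos V) (hne : V.Nonempty) :
    ∃ p : ℕ → Pt, Set.BijOn p (range #V) V ∧ ∀ i j k l, i < j → j < k → k < l → l < #V →
      (openSegment ℝ (p i) (p k) ∩ openSegment ℝ (p j) (p l)).Nonempty := by
  obtain ⟨κ, hinj, harea⟩ := hV.exists_key_s5 hne
  obtain ⟨p, hp, hmono⟩ := exists_enumeration_of_injOn V κ hinj
  refine ⟨p, hp, fun i j k l hij hjk hkl hl => ?_⟩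
  have hmem : ∀ i < #V, p i ∈ V := fun i hi => hp.mapsTo (by simpa using hi)
  have key : ∀ i j k, i < j → j < k → k < #V → 0 < signedArea (p i) (p j) (p k) :=
    fun i j k hij hjk hk => harea _ (hmem i (by omega)) _ (hmem j (by omega)) _ (hmem k hk)
      (hmono i j hij (by omega)) (hmono j k hjk hk)
  exact openSegment_inter_nonempty_of_signedArea_pos (key i j k hij hjk (by omega))
    (key i j l hij (by omega) hl) (key i k l (by omega) hkl hl) (key j k l hjk hkl hl)

theorem two_mul_sum_range_sub_succ_add (m : ℕ) {l : ℕ} (hl : m ≤ l) :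
    2 * ∑ i ∈ range l, (m - (i + 1)) + m = m * m := by
  have h : ∑ i ∈ range l, (m - (i + 1)) = ∑ i ∈ range m, (m - (i + 1)) := by
    refine (sum_subset (range_subset_range.2 hl) fun i _ hi => ?_).symm
    simp only [mem_range] at hi
    omega
  have h2 : ∑ i ∈ range m, (m - (i + 1)) = ∑ i ∈ range m, i :=
    (sum_congr rfl fun i _ => by omega).trans (sum_range_reflect (fun i => i) m)
  rw [h, h2, mul_comm 2, sum_range_id_mul_two]
  cases m <;> simp [Nat.mul_succ, Nat.succ_mul]

/-- In a graph on `{0, …, n - 1}` of minimum degree at least `2 * m + 1`, some chord is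
interleaved with at least `m * m` others. -/
theorem exists_adj_mul_self_le_card {n m : ℕ} (hn : 0 < n) (adj : ℕ → ℕ → Prop)
    (hsymm : ∀ u v, adj u v → adj v u) (hirr : ∀ u, ¬ adj u u)
    (hdeg : ∀ u < n, 2 * m + 1 ≤ #{w ∈ range n | adj u w}) :
    ∃ a b, a < b ∧ b < n ∧ adj a b ∧
      m * m ≤ #{x ∈ range n ×ˢ range n | adj x.1 x.2 ∧ (a < x.1 ∧ x.1 < b) ∧
        (x.2 < a ∨ b < x.2)} := by
  have hex : ∃ s, m < s ∧ ∃ a, a + s < n ∧ adj a (a + s) := by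
    by_contra! h
    have hsub : {w ∈ range n | adj 0 w} ⊆ Ioc 0 m := by
      intro w hw
      simp only [mem_filter, mem_range, mem_Ioc] at hw ⊢
      refine ⟨Nat.pos_of_ne_zero fun h0 => hirr 0 (h0 ▸ hw.2), ?_⟩
      by_contra! hmw
      exact h w hmw 0 (by omega) (by simpa using hw.2)
    have h1 := card_le_card hsub
    have h2 := hdeg 0 hn
    simp at h1
    omega
  obtain ⟨s, ⟨hms, a, has, hadj⟩, hmin⟩ : ∃ s, (m < s ∧ ∃ a, a + s < n ∧ adj a (a + s)) ∧
      ∀ t < s, ¬ (m < t ∧ ∃ a, a + t < n ∧ adj a (a + t)) :=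
    ⟨Nat.find hex, Nat.find_spec hex, fun t ht => Nat.find_min hex ht⟩
  refine ⟨a, a + s, by omega, has, hadj, ?_⟩
  have hshort : ∀ u v, a ≤ u → v ≤ a + s → v - u < s → u < v → adj u v → v ≤ u + m := by
    intro u v hu hv huv hlt h
    by_contra! hm
    exact hmin (v - u) huv ⟨by omega, u, by omega, by rwa [Nat.add_sub_cancel' hlt.le]⟩
  have hout : ∀ i < s - 1, (m - (i + 1)) + (m - (s - 1 - 1 - i + 1)) + 1 ≤
      #{w ∈ range n | adj (a + (i + 1)) w ∧ (w < a ∨ a + s < w)} := by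
    intro i hi
    set u := a + (i + 1) with hu
    have hsub : {w ∈ range n | adj u w} ⊆
        {w ∈ range n | adj u w ∧ (w < a ∨ a + s < w)} ∪
          (Ico (u - min m (i + 1)) u ∪ Ioc u (u + min m (s - (i + 1)))) := by
      intro w hw
      simp only [mem_filter, mem_range] at hw
      simp only [mem_union, mem_filter, mem_range, mem_Ico, mem_Ioc]
      by_cases hwo : w < a ∨ a + s < w
      · exact Or.inl ⟨hw.1, hw.2, hwo⟩
      · right
        rcases lt_trichotomy w u with h | h | h
        · have := hshort w u (by omega) (by omega) (by omega) h (hsymm _ _ hw.2)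
          omega
        · exact absurd (h ▸ hw.2) (hirr u)
        · have := hshort u w (by omega) (by omega) (by omega) h hw.2
          omega
    have h1 := (card_le_card hsub).trans (card_union_le _ _)
    have h2 := card_union_le (Ico (u - min m (i + 1)) u) (Ioc u (u + min m (s - (i + 1))))
    have h3 := hdeg u (by omega)
    simp only [Nat.card_Ico, Nat.card_Ioc] at h2
    omega
  have hcount : ∑ i ∈ range (s - 1), #{w ∈ range n | adj (a + (i + 1)) w ∧ (w < a ∨ a + s < w)} ≤
      #{x ∈ range n ×ˢ range n | adj x.1 x.2 ∧ (a < x.1 ∧ x.1 < a + s) ∧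
        (x.2 < a ∨ a + s < x.2)} := by
    rw [← card_sigma]
    refine card_le_card_of_injOn (fun y => (a + (y.1 + 1), y.2)) ?_ ?_
    · rintro ⟨i, w⟩ h
      simp only [coe_sigma, Set.mem_sigma_iff, mem_coe, mem_range, mem_filter, mem_product] at h ⊢
      exact ⟨⟨by omega, h.2.1⟩, h.2.2.1, by omega, h.2.2.2⟩
    · rintro ⟨i, w⟩ _ ⟨j, v⟩ _ h
      simp only [Prod.mk.injEq] at h
      obtain ⟨h1, rfl⟩ := h
      obtain rfl : i = j := by omega
      rfl
  refine le_trans ?_ ((sum_le_sum fun i hi => hout i (mem_range.1 hi)).trans hcount)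
  rw [sum_add_distrib, sum_add_distrib,
    sum_range_reflect (fun j => m - (j + 1)) (s - 1), sum_const, card_range, smul_eq_mul]
  have := two_mul_sum_range_sub_succ_add m (l := s - 1) (by omega)
  omega

theorem degree_le_card_filter_range (G : ConvexGeomGraph) {p : ℕ → Pt} {n u : ℕ}
    (hp : Set.BijOn p (range n) G.V) :
    degree G (p u) ≤ #{w ∈ range n | s(p u, p w) ∈ G.E} := by
  have hsub : G.E.filter (fun e => p u ∈ e) ⊆
      ({w ∈ range n | s(p u, p w) ∈ G.E} : Finset ℕ).image (fun w => s(p u, p w)) := by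
    intro e he
    obtain ⟨heE, hu⟩ := mem_filter.1 he
    obtain ⟨y, rfl⟩ := hu
    obtain ⟨w, hw, rfl⟩ := hp.surjOn (G.mem_V _ heE y (Sym2.mem_mk_right _ _))
    exact mem_image.2 ⟨w, mem_filter.2 ⟨hw, heE⟩, rfl⟩
  exact (card_le_card hsub).trans card_image_le

/-- every nonempty outer k-planar graph has a vertex of degree at
most 2·√(k+1) + 2. -/
theorem stmt5 (k : ℕ) (G : ConvexGeomGraph) (hG : OuterKPlanar G k)
    (hne : G.V.Nonempty) :
    ∃ v ∈ G.V, (degree G v : ℝ) ≤ 2 * Real.sqrt (k + 1) + 2 := by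
  by_contra! hdeg
  obtain ⟨p, hp, hcross⟩ := G.convexPos.exists_enumeration hne
  have hmem : ∀ i < #G.V, p i ∈ G.V := fun i hi => hp.mapsTo (by simpa using hi)
  have hinj : ∀ i < #G.V, ∀ j < #G.V, p i = p j → i = j := fun i hi j hj h =>
    hp.injOn (by simpa using hi) (by simpa using hj) h
  obtain ⟨a, b, hab, hb, hE, hcard⟩ := exists_adj_mul_self_le_card (m := Nat.sqrt (k + 1) + 1)
    (card_pos.2 hne) (fun u w => s(p u, p w) ∈ G.E) (fun u v h => by rwa [Sym2.eq_swap])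
    (fun u h => G.not_diag _ h (by simp)) (by
      intro u hu
      refine le_trans ?_ ((degree_le_card_filter_range G hp).trans_eq (by congr!))
      have h1 := hdeg (p u) (hmem u hu)
      have h2 : ((Nat.sqrt (k + 1) : ℕ) : ℝ) ≤ Real.sqrt (k + 1) := by
        exact_mod_cast Real.nat_sqrt_le_real_sqrt (a := k + 1)
      have h3 : ((2 * Nat.sqrt (k + 1) + 2 : ℕ) : ℝ) < degree G (p u) := by
        push_cast; linarith
      have h4 : 2 * Nat.sqrt (k + 1) + 2 < degree G (p u) := by exact_mod_cast h3
      omega)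
  refine absurd ((hcard.trans ?_).trans (hG _ hE)) ?_
  · refine card_le_card_of_injOn (fun x => s(p x.1, p x.2)) ?_ ?_
    · rintro ⟨u, w⟩ h
      simp only [mem_coe, mem_filter, mem_product, mem_range] at h ⊢
      obtain ⟨⟨hu, hw⟩, huw, ⟨hau, hub⟩, hwo⟩ := h
      refine ⟨huw, fun heq => ?_, ?_⟩
      · have : p u ∈ s(p a, p b) := heq ▸ Sym2.mem_mk_left _ _
        rcases Sym2.mem_iff.1 this with h | h
        · exact hau.ne' (hinj u hu a (by omega) h)
        · exact hub.ne (hinj u hu b hb h)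
      · simp only [edgeSeg, Sym2.lift_mk]
        rcases hwo with h | h
        · have := hcross w a u b h hau hub hb
          rwa [Set.inter_comm, openSegment_symm ℝ (p w)] at this
        · exact hcross a u b w hau hub h hw
    · rintro ⟨u, w⟩ h ⟨u', w'⟩ h' heq
      simp only [mem_coe, mem_filter, mem_product, mem_range] at h h'
      rcases Sym2.eq_iff.1 heq with ⟨h1, h2⟩ | ⟨h1, h2⟩
      · rw [hinj u h.1.1 u' h'.1.1 h1, hinj w h.1.2 w' h'.1.2 h2]
      · have := hinj u h.1.1 w' h'.1.2 h1
        omega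
  · have := Nat.lt_succ_sqrt (k + 1)
    simp only [Nat.succ_eq_add_one] at this
    omega
end

section
/- Let n and r be positive integers with 2r < n, and let G be the circulant graph C_n^{1,2,…,r}. Then the value of every cut of G is at most ((5r/8) + 76)·n; in particular mc(G) ≤ ((5r/8) + 76)·n. -/
open scoped Classical

/-- Adjacency in the circulant graph `C_n^{1,2,…,r}`: distinct vertices of
`ℤ/nℤ` are adjacent iff their difference is `±t (mod n)` for some `1 ≤ t ≤ r`. -/
def circAdj (n r : ℕ) (i j : ZMod n) : Prop :=
  i ≠ j ∧ ∃ t : ℕ, 1 ≤ t ∧ t ≤ r ∧ (i - j = (t : ZMod n) ∨ j - i = (t : ZMod n))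

theorem circAdj_comm (n r : ℕ) (i j : ZMod n) : circAdj n r i j ↔ circAdj n r j i := by
  constructor <;> rintro ⟨hne, t, h1, h2, h3⟩ <;> exact ⟨hne.symm, t, h1, h2, h3.symm⟩

/-- The value of the cut determined by `S`: the number of edges of
`C_n^{1,2,…,r}` with exactly one endpoint in `S`. -/
noncomputable def cutValue (n r : ℕ) (S : Set (ZMod n)) : ℕ :=
  Set.ncard {pr : Sym2 (ZMod n) | Sym2.lift
    ⟨fun i j => circAdj n r i j ∧ ((i ∈ S ∧ j ∉ S) ∨ (j ∈ S ∧ i ∉ S)),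
     fun i j => propext (by
       constructor <;> rintro ⟨h1, h2⟩ <;>
         exact ⟨(circAdj_comm n r _ _).mp h1, h2.symm⟩)⟩ pr}

theorem Real.neg_div_four_le_sin {u : ℝ} (hu : 0 ≤ u) : -(u / 4) ≤ Real.sin u := by
  have hpi := Real.pi_gt_three
  rcases le_or_gt u Real.pi with h | h
  · linarith [Real.sin_nonneg_of_nonneg_of_le_pi hu h]
  · rcases le_or_gt u 4 with h4 | h4
    · have h1 : Real.sin (u - Real.pi) ≤ u - Real.pi := Real.sin_le (by linarith)
      rw [Real.sin_sub_pi] at h1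
      linarith
    · linarith [Real.neg_one_le_sin u]

theorem Real.two_mul_sin_mul_sum_cos (φ : ℝ) (r : ℕ) :
    2 * Real.sin φ * ∑ t ∈ Finset.Icc 1 r, Real.cos (2 * t * φ) =
      Real.sin ((2 * r + 1) * φ) - Real.sin φ := by
  induction r with
  | zero => simp
  | succ k ih =>
    rw [Finset.sum_Icc_succ_top (by omega), mul_add, ih]
    push_cast
    have e1 : (2 * (k : ℝ) + 1) * φ = 2 * (k + 1) * φ - φ := by ring
    have e2 : (2 * ((k : ℝ) + 1) + 1) * φ = 2 * (k + 1) * φ + φ := by ring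
    rw [e1, e2, Real.sin_sub, Real.sin_add]
    ring

theorem sum_cos_lower_bound_of_le_pi_div_two {φ : ℝ} (h0 : 0 ≤ φ) (h1 : φ ≤ Real.pi / 2) (r : ℕ) :
    -((r : ℝ) / 4 + 152) ≤ ∑ t ∈ Finset.Icc 1 r, Real.cos (2 * t * φ) := by
  have hr : (0 : ℝ) ≤ r := r.cast_nonneg
  rcases h0.eq_or_lt with rfl | hpos
  · simp only [mul_zero, Real.cos_zero, Finset.sum_const, Nat.card_Icc, nsmul_eq_mul]
    simp
    linarith
  have hs : 0 < Real.sin φ :=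
    Real.sin_pos_of_pos_of_lt_pi hpos (by linarith [Real.pi_pos])
  have key := Real.two_mul_sin_mul_sum_cos φ r
  set s := Real.sin φ
  have hsin : 0 ≤ Real.sin ((2 * r + 1) * φ) + s * ((2 * r + 1) / 4 + 302) := by
    rcases le_or_gt 1 φ with hφ | hφ
    · have h2 : 2 / Real.pi * φ ≤ s := Real.mul_le_sin h0 h1
      have h3 : 1 / 2 ≤ 2 / Real.pi := by
        rw [div_le_div_iff₀ (by norm_num) Real.pi_pos]
        linarith [Real.pi_le_four]
      have h4 : 1 / 2 ≤ s := by nlinarith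
      nlinarith [Real.neg_one_le_sin ((2 * r + 1) * φ)]
    · have h2 : φ - φ ^ 3 / 4 ≤ s := by
        linarith [Real.sin_gt_sub_cube hpos, pow_pos hpos 3]
      have hsq : φ ^ 2 ≤ φ := by nlinarith
      have h3 : 3 / 4 * φ ≤ s := by nlinarith
      have h4 : (φ - φ ^ 3 / 4) * (2 * r + 1) ≤ s * (2 * r + 1) :=
        mul_le_mul_of_nonneg_right h2 (by positivity)
      set u := (2 * (r : ℝ) + 1) * φ with hu
      have h5 : (φ - φ ^ 3 / 4) * (2 * r + 1) = u * (1 - φ ^ 2 / 4) := by rw [hu]; ring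
      rw [h5] at h4
      rcases le_or_gt u 5 with h | h
      · have := Real.neg_div_four_le_sin (u := u) (by positivity)
        nlinarith [mul_le_mul_of_nonneg_right h (sq_nonneg φ)]
      · have := Real.neg_one_le_sin u
        nlinarith [mul_le_mul_of_nonneg_right h.le (by nlinarith : 0 ≤ 1 - φ ^ 2 / 4)]
  have : 0 ≤ 2 * s * (∑ t ∈ Finset.Icc 1 r, Real.cos (2 * t * φ) + (r / 4 + 152)) := by
    rw [mul_add, key]
    nlinarith
  linarith [nonneg_of_mul_nonneg_right this (by positivity)]

theorem sum_cos_lower_bound {φ : ℝ} (h0 : 0 ≤ φ) (h1 : φ ≤ Real.pi) (r : ℕ) :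
    -((r : ℝ) / 4 + 152) ≤ ∑ t ∈ Finset.Icc 1 r, Real.cos (2 * t * φ) := by
  rcases le_or_gt φ (Real.pi / 2) with h | h
  · exact sum_cos_lower_bound_of_le_pi_div_two h0 h r
  · refine (sum_cos_lower_bound_of_le_pi_div_two (φ := Real.pi - φ)
      (by linarith) (by linarith) r).trans_eq (Finset.sum_congr rfl fun t _ => ?_)
    rw [show 2 * (t : ℝ) * (Real.pi - φ) = t * (2 * Real.pi) - 2 * t * φ by ring,
      Real.cos_nat_mul_two_pi_sub]

theorem ZMod.re_stdAddChar_mul_natCast {n : ℕ} [NeZero n] (k : ZMod n) (t : ℕ) :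
    (ZMod.stdAddChar (k * (t : ZMod n))).re = Real.cos (2 * t * (Real.pi * k.val / n)) := by
  have h : k * (t : ZMod n) = ((k.val * t : ℕ) : ℤ) := by simp
  rw [h, ZMod.stdAddChar_coe]
  have e : 2 * (Real.pi : ℂ) * Complex.I * (((k.val * t : ℕ) : ℤ) : ℂ) / n =
      ((2 * t * (Real.pi * k.val / n) : ℝ) : ℂ) * Complex.I := by
    push_cast; ring
  rw [e, Complex.exp_ofReal_mul_I_re]

/-- The autocorrelation of `x` at `t` is the Fourier transform of its power spectrum. -/
theorem ZMod.sum_normSq_mul_stdAddChar {n : ℕ} [NeZero n] (x : ZMod n → ℝ) (t : ZMod n) :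
    ∑ k : ZMod n, (Complex.normSq (∑ i, (x i : ℂ) * ZMod.stdAddChar (k * i)) : ℂ) *
      ZMod.stdAddChar (k * t) = n * ∑ i, (x i : ℂ) * x (i + t) := by
  have h : ∀ k : ZMod n, (Complex.normSq (∑ i, (x i : ℂ) * ZMod.stdAddChar (k * i)) : ℂ) *
      ZMod.stdAddChar (k * t) =
      ∑ i, ∑ j, (x i : ℂ) * x j * ZMod.stdAddChar (k * (i + t - j)) := by
    intro k
    rw [← Complex.mul_conj, map_sum, Finset.sum_mul_sum, Finset.sum_mul]
    refine Finset.sum_congr rfl fun i _ => ?_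
    rw [Finset.sum_mul]
    refine Finset.sum_congr rfl fun j _ => ?_
    rw [map_mul (starRingEnd ℂ), Complex.conj_ofReal, ← AddChar.map_neg_eq_conj,
      show k * (i + t - j) = k * i + -(k * j) + k * t by ring, AddChar.map_add_eq_mul,
      AddChar.map_add_eq_mul]
    ring
  simp_rw [h]
  rw [Finset.sum_comm, Finset.mul_sum]
  refine Finset.sum_congr rfl fun i _ => ?_
  rw [Finset.sum_comm]
  simp_rw [← Finset.mul_sum,
    AddChar.sum_mulShift _ (ZMod.isPrimitive_stdAddChar n), sub_eq_zero]
  simp [mul_comm, ZMod.card]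

theorem autocorrelation_sum_lower_bound {n : ℕ} [NeZero n] (x : ZMod n → ℝ) (r : ℕ) :
    -((r : ℝ) / 4 + 152) * ∑ i, x i ^ 2 ≤
      ∑ t ∈ Finset.Icc 1 r, ∑ i, x i * x (i + (t : ZMod n)) := by
  have hn : (0 : ℝ) < n := Nat.cast_pos.mpr (NeZero.pos n)
  have h : ∀ t : ℕ, ∑ k : ZMod n, Complex.normSq (∑ i, (x i : ℂ) * ZMod.stdAddChar (k * i)) *
      Real.cos (2 * t * (Real.pi * k.val / n)) = n * ∑ i, x i * x (i + (t : ZMod n)) := by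
    intro t
    have := congrArg Complex.re (ZMod.sum_normSq_mul_stdAddChar x t)
    simp only [Complex.re_sum, Complex.re_ofReal_mul, ZMod.re_stdAddChar_mul_natCast] at this
    rw [this]
    norm_cast
  have h0 := h 0
  simp only [Nat.cast_zero, mul_zero, zero_mul, Real.cos_zero, mul_one, add_zero, ← pow_two] at h0
  refine le_of_mul_le_mul_left ?_ hn
  rw [mul_left_comm, ← h0, Finset.mul_sum, Finset.mul_sum]
  simp_rw [← h]
  rw [Finset.sum_comm]
  refine Finset.sum_le_sum fun k _ => ?_
  rw [← Finset.mul_sum, mul_comm]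
  refine mul_le_mul_of_nonneg_left (sum_cos_lower_bound (by positivity) ?_ r)
    (Complex.normSq_nonneg _)
  rw [div_le_iff₀ hn]
  exact mul_le_mul_of_nonneg_left (Nat.cast_le.mpr k.val_lt.le) Real.pi_pos.le

theorem cutValue_le_sum {n : ℕ} [NeZero n] (r : ℕ) (S : Set (ZMod n)) :
    cutValue n r S ≤ ∑ t ∈ Finset.Icc 1 r, ∑ i : ZMod n,
      if (i ∈ S ↔ i + (t : ZMod n) ∈ S) then 0 else 1 := by
  have hsub : {pr : Sym2 (ZMod n) | Sym2.lift
      ⟨fun i j => circAdj n r i j ∧ ((i ∈ S ∧ j ∉ S) ∨ (j ∈ S ∧ i ∉ S)),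
       fun i j => propext (by
         constructor <;> rintro ⟨h1, h2⟩ <;>
           exact ⟨(circAdj_comm n r _ _).mp h1, h2.symm⟩)⟩ pr} ⊆
      (((Finset.Icc 1 r ×ˢ (Finset.univ : Finset (ZMod n))).filter fun p =>
        ¬ (p.2 ∈ S ↔ p.2 + (p.1 : ZMod n) ∈ S)).image
          fun p => s(p.2, p.2 + (p.1 : ZMod n)) : Finset (Sym2 (ZMod n))) := by
    intro pr
    induction pr using Sym2.ind with
    | _ i j =>
      rintro ⟨⟨-, t, h1, h2, h3⟩, h4⟩
      simp only [Finset.coe_image, Set.mem_image, Finset.mem_coe, Finset.mem_filter,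
        Finset.mem_product, Finset.mem_Icc, Finset.mem_univ, and_true, Prod.exists]
      rcases h3 with h3 | h3
      · obtain rfl : i = j + t := by rw [← h3]; ring
        exact ⟨t, j, ⟨⟨h1, h2⟩, by tauto⟩, Sym2.eq_swap⟩
      · obtain rfl : j = i + t := by rw [← h3]; ring
        exact ⟨t, i, ⟨⟨h1, h2⟩, by tauto⟩, rfl⟩
  refine (Set.ncard_le_ncard hsub (Finset.finite_toSet _)).trans ?_
  rw [Set.ncard_coe_finset]
  refine Finset.card_image_le.trans_eq ?_
  rw [Finset.card_filter, Finset.sum_product]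
  simp only [ite_not]

/-- every cut of the circulant graph `C_n^{1,2,…,r}` (with
`2r < n`) has value at most `((5r/8) + 76)·n`; in particular this bounds the
maximum cut. -/
theorem stmt9 (n r : ℕ) (hn : 0 < n) (hr : 0 < r) (hrn : 2 * r < n)
    (S : Set (ZMod n)) :
    (cutValue n r S : ℝ) ≤ (5 * r / 8 + 76) * n := by
  have : NeZero n := ⟨hn.ne'⟩
  set x : ZMod n → ℝ := fun i => if i ∈ S then 1 else -1 with hx
  have hsq : ∑ i, x i ^ 2 = n := by
    have : ∀ i, x i ^ 2 = 1 := fun i => by simp only [hx]; split_ifs <;> norm_num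
    simp [this, ZMod.card]
  have hcut : (cutValue n r S : ℝ) ≤
      ∑ t ∈ Finset.Icc 1 r, ∑ i : ZMod n, (1 - x i * x (i + (t : ZMod n))) / 2 := by
    refine (Nat.cast_le.mpr (cutValue_le_sum r S)).trans_eq ?_
    push_cast
    refine Finset.sum_congr rfl fun t _ => Finset.sum_congr rfl fun i _ => ?_
    by_cases h1 : i ∈ S <;> by_cases h2 : i + (t : ZMod n) ∈ S <;> norm_num [hx, h1, h2]
  have hcorr := autocorrelation_sum_lower_bound x r
  rw [hsq] at hcorr
  simp only [← Finset.sum_div, Finset.sum_sub_distrib, Finset.sum_const, Finset.card_univ,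
    ZMod.card, Nat.card_Icc, nsmul_eq_mul, add_tsub_cancel_right, mul_one] at hcut
  linarith
end
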